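/- arXiv:math-ph/0512091 — 4 statements merged into one kernel-verified Lean document; each statement's English description precedes it below -/
import Mathlib

section
/- Suppose the assumptions of the closure theorem hold: A(t), t ∈ I, are Kato-stable generators with strongly continuous resolvent t ↦ R(ω', A(t)) for some ω' > ω, (ω' − G₀)F_p is dense in E_p, and F_p is dense in E_p and C_0(I,X), so that the closure G of G₀ generates an evolution semigroup given by an evolution family U(·,·). Let Y ⊆ D(A(t)) for all t ∈ I and suppose t ↦ A(t)y is continuous in X for every y ∈ Y. Then for (t,s) ∈ D_I and y ∈ Y: ∂/∂s U(t,s)y = −U(t,s)A(s)y (one-sided derivative if t = s), and the right derivative of t ↦ U(t,s)y at t = s equals A(s)y. If U(·,·) is invertible and I = ℝ, these formulas hold for all t, s ∈ ℝ with two-sided derivatives at t = s. -/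
open MeasureTheory Set Real Filter
open scoped ENNReal Topology Classical

variable {X : Type*} [NormedAddCommGroup X] [NormedSpace ℝ X] [CompleteSpace X]

/-- `f ∈ F_p = W^{1,p}_0(I,X) ∩ D(A(·))`, witnessed by a continuous
representative `g` with derivative `g'` and `A(·)g(·) = af`. -/
def MemFp (I : Set ℝ) (Dom : ℝ → Set X) (Aop : ℝ → X → X) (p : ℝ≥0∞)
    (f : Lp X p (volume.restrict I)) (g g' af : ℝ → X) : Prop :=
  (⇑f =ᵐ[volume.restrict I] g) ∧
  Continuous g ∧ (∀ t ∉ I, g t = 0) ∧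
  Tendsto g (cocompact ℝ) (𝓝 0) ∧
  (∀ s ∈ I, ∀ t ∈ I, g t - g s = ∫ τ in s..t, g' τ) ∧
  MemLp g' p (volume.restrict I) ∧
  (∀ᵐ t ∂(volume.restrict I), g t ∈ Dom t ∧ af t = Aop t (g t)) ∧
  MemLp af p (volume.restrict I)

omit [CompleteSpace X] in
theorem tendsto_evolution_apply {I : Set ℝ} {U : ℝ → ℝ → X →L[ℝ] X}
    (hU_cont : ∀ x : X, ContinuousOn (fun q : ℝ × ℝ => U q.1 q.2 x)
      {q : ℝ × ℝ | q.1 ∈ I ∧ q.2 ∈ I ∧ q.2 ≤ q.1})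
    (hU_bound : ∃ M' ω'' : ℝ, 1 ≤ M' ∧ ∀ t ∈ I, ∀ s ∈ I, s ≤ t →
      ‖U t s‖ ≤ M' * exp (ω'' * (t - s)))
    {Z : Type*} {l : Filter Z} {a b : Z → ℝ} {z : Z → X} {a₀ b₀ : ℝ} {z₀ : X}
    (ha : Tendsto a l (𝓝 a₀)) (hb : Tendsto b l (𝓝 b₀)) (hz : Tendsto z l (𝓝 z₀))
    (h₀ : a₀ ∈ I ∧ b₀ ∈ I ∧ b₀ ≤ a₀) (h : ∀ᶠ q in l, a q ∈ I ∧ b q ∈ I ∧ b q ≤ a q) :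
    Tendsto (fun q => U (a q) (b q) (z q)) l (𝓝 (U a₀ b₀ z₀)) := by
  obtain ⟨M', ω'', -, hB⟩ := hU_bound
  have h1 : Tendsto (fun q => U (a q) (b q) z₀) l (𝓝 (U a₀ b₀ z₀)) :=
    (hU_cont z₀ (a₀, b₀) h₀).tendsto.comp
      (tendsto_nhdsWithin_iff.2 ⟨ha.prodMk_nhds hb, h⟩)
  have h2 : Tendsto (fun q => U (a q) (b q) (z q - z₀)) l (𝓝 0) := by
    have h3 : Tendsto (fun q => M' * exp (ω'' * (a q - b q)) * ‖z q - z₀‖) l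
        (𝓝 (M' * exp (ω'' * (a₀ - b₀)) * ‖z₀ - z₀‖)) :=
      (((continuous_exp.tendsto _).comp ((ha.sub hb).const_mul ω'')).const_mul M').mul
        (hz.sub_const z₀).norm
    rw [sub_self, norm_zero, mul_zero] at h3
    refine squeeze_zero_norm' ?_ h3
    filter_upwards [h] with q hq
    exact (U (a q) (b q)).le_of_opNorm_le (hB _ hq.1 _ hq.2.1 hq.2.2) _
  simpa using h2.add h1

omit [CompleteSpace X] in
theorem ContinuousOn.evolution_apply {I : Set ℝ} {U : ℝ → ℝ → X →L[ℝ] X}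
    (hU_cont : ∀ x : X, ContinuousOn (fun q : ℝ × ℝ => U q.1 q.2 x)
      {q : ℝ × ℝ | q.1 ∈ I ∧ q.2 ∈ I ∧ q.2 ≤ q.1})
    (hU_bound : ∃ M' ω'' : ℝ, 1 ≤ M' ∧ ∀ t ∈ I, ∀ s ∈ I, s ≤ t →
      ‖U t s‖ ≤ M' * exp (ω'' * (t - s)))
    {Z : Type*} [TopologicalSpace Z] {S : Set Z} {a b : Z → ℝ} {z : Z → X}
    (ha : ContinuousOn a S) (hb : ContinuousOn b S) (hz : ContinuousOn z S)
    (haI : ∀ q ∈ S, a q ∈ I) (hbI : ∀ q ∈ S, b q ∈ I) (hba : ∀ q ∈ S, b q ≤ a q) :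
    ContinuousOn (fun q => U (a q) (b q) (z q)) S := fun q hq =>
  tendsto_evolution_apply hU_cont hU_bound (ha q hq) (hb q hq) (hz q hq)
    ⟨haI q hq, hbI q hq, hba q hq⟩
    (eventually_mem_nhdsWithin.mono fun r hr => ⟨haI r hr, hbI r hr, hba r hr⟩)

omit [CompleteSpace X] in
theorem exists_clm_integral_apply {I : Set ℝ} {c d : ℝ} (hcd : Ioc c d ⊆ I)
    {p : ℝ≥0∞} [Fact (1 ≤ p)] {V : ℝ → X →L[ℝ] X} {C : ℝ}
    (hVc : Continuous fun q : ℝ × X => V q.1 q.2) (hV : ∀ t, ‖V t‖ ≤ C) :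
    ∃ Λ : Lp X p (volume.restrict I) →L[ℝ] X,
      ∀ f, Λ f = ∫ t in Ioc c d, V t (f t) := by
  have hp1 : (1 : ℝ≥0∞) ≤ p := Fact.out
  have hle : volume.restrict (Ioc c d) ≤ volume.restrict I := Measure.restrict_mono hcd le_rfl
  have hC : 0 ≤ C := (norm_nonneg _).trans (hV 0)
  have hmem : ∀ f : Lp X p (volume.restrict I), MemLp f p (volume.restrict (Ioc c d)) :=
    fun f => (Lp.memLp f).mono_measure hle
  have hmeas : ∀ f : Lp X p (volume.restrict I),
      AEStronglyMeasurable (fun t => V t (f t)) (volume.restrict (Ioc c d)) := fun f =>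
    hVc.comp_aestronglyMeasurable
      (continuous_id.aestronglyMeasurable.prodMk (hmem f).aestronglyMeasurable)
  have h_int : ∀ f : Lp X p (volume.restrict I),
      Integrable (fun t => V t (f t)) (volume.restrict (Ioc c d)) := fun f =>
    (((hmem f).integrable hp1).norm.const_mul C).mono' (hmeas f)
      (ae_of_all _ fun t => (V t).le_of_opNorm_le (hV t) _)
  have hadd : ∀ f g : Lp X p (volume.restrict I),
      (fun t => V t ((f + g : Lp X p (volume.restrict I)) t))
        =ᵐ[volume.restrict (Ioc c d)] fun t => V t (f t) + V t (g t) := fun f g => by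
    filter_upwards [(Measure.absolutelyContinuous_of_le hle).ae_eq (Lp.coeFn_add f g)] with t ht
    rw [ht, Pi.add_apply, map_add]
  have hsmul : ∀ (r : ℝ) (f : Lp X p (volume.restrict I)),
      (fun t => V t ((r • f : Lp X p (volume.restrict I)) t))
        =ᵐ[volume.restrict (Ioc c d)] fun t => r • V t (f t) := fun r f => by
    filter_upwards [(Measure.absolutelyContinuous_of_le hle).ae_eq (Lp.coeFn_smul r f)] with t ht
    rw [ht, Pi.smul_apply, map_smul]
  let L : Lp X p (volume.restrict I) →ₗ[ℝ] X :=
    { toFun := fun f => ∫ t in Ioc c d, V t (f t)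
      map_add' := fun f g => by
        rw [integral_congr_ae (hadd f g), integral_add (h_int f) (h_int g)]
      map_smul' := fun r f => by
        rw [integral_congr_ae (hsmul r f), integral_smul, RingHom.id_apply] }
  set K : ℝ≥0∞ := (volume.restrict (Ioc c d)) univ ^ (1 / (1 : ℝ≥0∞).toReal - 1 / p.toReal)
    with hK
  have hKtop : K ≠ ∞ := by
    refine ENNReal.rpow_ne_top_of_nonneg ?_ (by simp)
    rcases eq_or_ne p ∞ with rfl | hp
    · simp
    · have h1 : 1 ≤ p.toReal := by
        simpa using (ENNReal.toReal_le_toReal ENNReal.one_ne_top hp).2 hp1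
      have : 1 / p.toReal ≤ 1 := by
        rw [div_le_one (by linarith)]; exact h1
      simpa using this
  refine ⟨L.mkContinuous (C * K.toReal) fun f => ?_, fun f => rfl⟩
  have h1 : ‖L f‖ ≤ C * ∫ t in Ioc c d, ‖f t‖ := by
    rw [← integral_const_mul]
    exact norm_integral_le_of_norm_le (((hmem f).integrable hp1).norm.const_mul C)
      (ae_of_all _ fun t => (V t).le_of_opNorm_le (hV t) _)
  have h2 : ∫ t in Ioc c d, ‖f t‖ ≤ K.toReal * ‖f‖ := by
    rw [integral_norm_eq_lintegral_enorm (hmem f).aestronglyMeasurable,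
      ← eLpNorm_one_eq_lintegral_enorm, Lp.norm_def, ← ENNReal.toReal_mul]
    refine ENNReal.toReal_mono (ENNReal.mul_ne_top hKtop (Lp.eLpNorm_ne_top f)) ?_
    refine (eLpNorm_le_eLpNorm_mul_rpow_measure_univ hp1
      (hmem f).aestronglyMeasurable).trans ?_
    rw [mul_comm]
    gcongr
  calc ‖L f‖ ≤ C * ∫ t in Ioc c d, ‖f t‖ := h1
    _ ≤ C * (K.toReal * ‖f‖) := by gcongr
    _ = C * K.toReal * ‖f‖ := by ring

theorem hasDerivWithinAt_of_sub_eq_integral {S : Set ℝ} (hS : S.OrdConnected) {W k : ℝ → X}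
    (hk : ContinuousOn k S) {s : ℝ} (hs : s ∈ S)
    (hW : ∀ x ∈ S, W x - W s = ∫ r in s..x, k r) : HasDerivWithinAt W (k s) S s := by
  rw [hasDerivWithinAt_iff_isLittleO, Asymptotics.isLittleO_iff]
  intro ε hε
  obtain ⟨δ, hδ, hkδ⟩ := Metric.continuousWithinAt_iff.1 (hk s hs) ε hε
  filter_upwards [self_mem_nhdsWithin, mem_nhdsWithin_of_mem_nhds (Metric.ball_mem_nhds s hδ)]
    with x hx hxδ
  have hsub : uIcc s x ⊆ S := hS.uIcc_subset hs hx
  have h_int : IntervalIntegrable k volume s x := (hk.mono hsub).intervalIntegrable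
  have h1 : W x - W s - (x - s) • k s = ∫ r in s..x, (k r - k s) := by
    rw [hW x hx, intervalIntegral.integral_sub h_int (by simp), intervalIntegral.integral_const]
  rw [h1]
  refine intervalIntegral.norm_integral_le_of_norm_le_const fun r hr => ?_
  have hr' := uIoc_subset_uIcc hr
  rw [← dist_eq_norm]
  refine (hkδ (hsub hr') ?_).le
  rw [Real.dist_eq]
  exact (abs_sub_left_of_mem_uIcc hr').trans_lt hxδ

/-- A smooth cut-off `φ` with `φ = 1` near `[c, d]` times a vector `y` lies in `F_p`, and
`G₀ (φ y)` agrees with `A(·) y` on `[c, d]`. -/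
theorem exists_memFp_eq_const_near {I : Set ℝ} {Dom : ℝ → Set X} {Aop : ℝ → X → X}
    {p : ℝ≥0∞} (hImeas : MeasurableSet I) {y : X} {c d δ : ℝ} (hcd : c < d) (hδ : 0 < δ)
    (hI : Icc (c - 2 * δ) (d + 2 * δ) ⊆ I)
    (hsmul : ∀ t ∈ I, ∀ r : ℝ, r • y ∈ Dom t ∧ Aop t (r • y) = r • Aop t y)
    (hA : ContinuousOn (fun t => Aop t y) I) :
    ∃ (f h : Lp X p (volume.restrict I)) (g g' af : ℝ → X),
      MemFp I Dom Aop p f g g' af ∧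
      (⇑h =ᵐ[volume.restrict I] fun t => -(g' t) + af t) ∧
      (∀ t ∈ Icc (c - δ) (d + δ), g t = y) ∧
      (∀ t ∈ Ioc c d, -(g' t) + af t = Aop t y) := by
  have hle : c - 2 * δ ≤ d + 2 * δ := by linarith
  let φ : ContDiffBump ((c + d) / 2) := ⟨(d - c) / 2 + δ, (d - c) / 2 + 2 * δ, by linarith,
    by linarith⟩
  have hφball : Metric.closedBall ((c + d) / 2) ((d - c) / 2 + 2 * δ) =
      Icc (c - 2 * δ) (d + 2 * δ) := by
    rw [Real.closedBall_eq_Icc]; congr 1 <;> ring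
  have hφ0 : ∀ t ∉ Icc (c - 2 * δ) (d + 2 * δ), φ t = 0 := fun t ht => by
    refine φ.zero_of_le_dist ?_
    rw [← hφball, Metric.mem_closedBall, not_le] at ht
    exact ht.le
  have hφ1 : ∀ t ∈ Icc (c - δ) (d + δ), φ t = 1 := fun t ht => by
    refine φ.one_of_mem_closedBall ?_
    have : Metric.closedBall ((c + d) / 2) ((d - c) / 2 + δ) = Icc (c - δ) (d + δ) := by
      rw [Real.closedBall_eq_Icc]; congr 1 <;> ring
    change t ∈ Metric.closedBall ((c + d) / 2) ((d - c) / 2 + δ)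
    rwa [this]
  have hφsm : ContDiff ℝ 1 φ := φ.contDiff
  have hφc : Continuous φ := hφsm.continuous
  have hφ'c : Continuous (deriv φ) := hφsm.continuous_deriv le_rfl
  have hφs : HasCompactSupport φ := φ.hasCompactSupport
  let P : ℝ → ℝ := fun t => projIcc (c - 2 * δ) (d + 2 * δ) hle t
  have hPc : Continuous P := continuous_subtype_val.comp continuous_projIcc
  have hPI : ∀ t, P t ∈ I := fun t => hI (projIcc _ _ hle t).2
  have hP : ∀ t ∈ Icc (c - 2 * δ) (d + 2 * δ), P t = t := fun t ht => by
    simp [P, projIcc_of_mem hle ht]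
  have haP : Continuous fun t => Aop (P t) y :=
    hA.comp_continuous hPc hPI
  have haf : ∀ t, φ t • Aop (P t) y = φ t • Aop t y := fun t => by
    by_cases ht : t ∈ Icc (c - 2 * δ) (d + 2 * δ)
    · rw [hP t ht]
    · simp [hφ0 t ht]
  have hgm : MemLp (fun t => φ t • y) p (volume.restrict I) :=
    (((hφc.smul continuous_const).memLp_of_hasCompactSupport hφs.smul_right)).restrict I
  have hg'm : MemLp (fun t => deriv φ t • y) p (volume.restrict I) :=
    (((hφ'c.smul continuous_const).memLp_of_hasCompactSupport hφs.deriv.smul_right)).restrict I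
  have hafm : MemLp (fun t => φ t • Aop (P t) y) p (volume.restrict I) :=
    (((hφc.smul haP).memLp_of_hasCompactSupport hφs.smul_right)).restrict I
  refine ⟨hgm.toLp _, (hg'm.neg.add hafm).toLp _, fun t => φ t • y, fun t => deriv φ t • y,
    fun t => φ t • Aop (P t) y, ⟨hgm.coeFn_toLp, by fun_prop, ?_, ?_, ?_, hg'm, ?_, hafm⟩,
    (hg'm.neg.add hafm).coeFn_toLp, ?_, ?_⟩
  · intro t ht
    simp [hφ0 t fun h => ht (hI h)]
  · exact (hφs.smul_right (f' := fun _ => y)).is_zero_at_infty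
  · intro s _ t _
    rw [intervalIntegral.integral_smul_const, intervalIntegral.integral_deriv_eq_sub
      (fun x _ => (hφsm.differentiable one_ne_zero) x) (hφ'c.intervalIntegrable _ _), sub_smul]
  · filter_upwards [ae_restrict_mem hImeas] with t ht
    exact ⟨(hsmul t ht _).1, by rw [(hsmul t ht _).2, haf]⟩
  · intro t ht
    simp [hφ1 t ht]
  · intro t ht
    have h1 : deriv φ t = 0 := by
      have : φ =ᶠ[𝓝 t] fun _ => (1 : ℝ) := by
        filter_upwards [Icc_mem_nhds (show c - δ < t by linarith [ht.1])
          (show t < d + δ by linarith [ht.2])] with r hr using hφ1 r hr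
      rw [this.deriv_eq, deriv_const]
    have h2 : φ t = 1 := hφ1 t ⟨by linarith [ht.1], by linarith [ht.2]⟩
    simp only [haf]
    simp only [h1, h2, zero_smul, neg_zero, zero_add, one_smul]

theorem evolution_sub_eq_integral_of_lt {I : Set ℝ} (hI : I.OrdConnected)
    (hImeas : MeasurableSet I)
    {Dom : ℝ → Set X} {Aop : ℝ → X → X} {p : ℝ≥0∞} [Fact (1 ≤ p)]
    {U : ℝ → ℝ → X →L[ℝ] X}
    {T : ℝ → (Lp X p (volume.restrict I) →L[ℝ] Lp X p (volume.restrict I))}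
    (hU_comp : ∀ t ∈ I, ∀ r ∈ I, ∀ s ∈ I, s ≤ r → r ≤ t →
      (U t r).comp (U r s) = U t s)
    (hU_cont : ∀ x : X, ContinuousOn (fun q : ℝ × ℝ => U q.1 q.2 x)
      {q : ℝ × ℝ | q.1 ∈ I ∧ q.2 ∈ I ∧ q.2 ≤ q.1})
    (hU_bound : ∃ M' ω'' : ℝ, 1 ≤ M' ∧ ∀ t ∈ I, ∀ s ∈ I, s ≤ t →
      ‖U t s‖ ≤ M' * exp (ω'' * (t - s)))
    (hT_eq : ∀ σ : ℝ, 0 ≤ σ → ∀ f : Lp X p (volume.restrict I),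
      ⇑(T σ f) =ᵐ[volume.restrict I]
        fun t => if t - σ ∈ I then U t (t - σ) (f (t - σ)) else 0)
    (hG0 : ∀ (f : Lp X p (volume.restrict I)) (g g' af : ℝ → X),
      MemFp I Dom Aop p f g g' af →
      ∀ h : Lp X p (volume.restrict I),
        (⇑h =ᵐ[volume.restrict I] fun t => -(g' t) + af t) →
        HasDerivWithinAt (fun σ => T σ f) h (Ici (0:ℝ)) 0)
    {y : X}
    (hsmul : ∀ t ∈ I, ∀ r : ℝ, r • y ∈ Dom t ∧ Aop t (r • y) = r • Aop t y)
    (hA : ContinuousOn (fun t => Aop t y) I)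
    {s c d t : ℝ} (hs : s ∈ I) (ht : t ∈ I) (hsc : s < c) (hcd : c < d) (hdt : d < t) :
    U t c y - U t d y = ∫ r in c..d, U t r (Aop r y) := by
  obtain ⟨δ, hδ, hδs, hδt⟩ : ∃ δ : ℝ, 0 < δ ∧ s ≤ c - 2 * δ ∧ d + 2 * δ ≤ t := by
    refine ⟨min (c - s) (t - d) / 2, by have := lt_min (sub_pos.2 hsc) (sub_pos.2 hdt); linarith,
      by have := min_le_left (c - s) (t - d); linarith,
      by have := min_le_right (c - s) (t - d); linarith⟩
  have hstI : Icc s t ⊆ I := hI.out hs ht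
  have hst : s ≤ t := by linarith
  obtain ⟨f, h, g, g', af, hF, hh, hg, hgA⟩ := exists_memFp_eq_const_near (p := p) hImeas hcd hδ
    ((Icc_subset_Icc hδs hδt).trans hstI) hsmul hA
  let P : ℝ → ℝ := fun t' => projIcc s t hst t'
  have hPc : Continuous P := continuous_subtype_val.comp continuous_projIcc
  have hPI : ∀ r, P r ∈ I := fun r => hstI (projIcc _ _ hst r).2
  have hPt : ∀ r, P r ≤ t := fun r => (projIcc _ _ hst r).2.2
  have hPs : ∀ r, s ≤ P r := fun r => (projIcc _ _ hst r).2.1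
  have hP : ∀ r ∈ Icc s t, P r = r := fun r hr => by simp [P, projIcc_of_mem hst hr]
  have hVc : Continuous fun q : ℝ × X => U t (P q.1) q.2 := by
    rw [← continuousOn_univ]
    exact ContinuousOn.evolution_apply hU_cont hU_bound continuousOn_const (by fun_prop)
      (by fun_prop) (fun _ _ => ht) (fun _ _ => hPI _) (fun _ _ => hPt _)
  have hcdI : Ioc c d ⊆ I := fun r hr => hstI ⟨by linarith [hr.1], by linarith [hr.2]⟩
  obtain ⟨C, hC⟩ : ∃ C, ∀ r, ‖U t (P r)‖ ≤ C := by
    obtain ⟨M', ω'', -, hB⟩ := hU_bound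
    have hb : Continuous fun r : ℝ => M' * exp (ω'' * (t - r)) := by fun_prop
    obtain ⟨C, hC⟩ := (isCompact_Icc (a := s) (b := t)).bddAbove_image hb.continuousOn
    exact ⟨C, fun r => (hB t ht _ (hPI r) (hPt r)).trans
      (hC ⟨P r, ⟨hPs r, hPt r⟩, rfl⟩)⟩
  obtain ⟨Λ, hΛ⟩ := exists_clm_integral_apply (p := p) hcdI hVc hC
  have hW : Continuous fun r => U t (P r) y :=
    hVc.comp (continuous_id.prodMk continuous_const)
  have hder : HasDerivWithinAt (fun σ => Λ (T σ f)) (Λ h) (Ici 0) 0 :=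
    Λ.hasFDerivAt.comp_hasDerivWithinAt 0 (hG0 f g g' af hF h hh)
  have hac : volume.restrict (Ioc c d) ≪ volume.restrict I :=
    Measure.absolutelyContinuous_of_le (Measure.restrict_mono hcdI le_rfl)
  have hΛh : Λ h = ∫ r in c..d, U t r (Aop r y) := by
    rw [hΛ, intervalIntegral.integral_of_le hcd.le]
    refine integral_congr_ae ?_
    filter_upwards [hac.ae_eq hh, ae_restrict_mem measurableSet_Ioc] with r hr hrcd
    rw [hr, hgA r hrcd, hP r ⟨by linarith [hrcd.1], by linarith [hrcd.2]⟩]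
  have hΛT : ∀ σ ∈ Icc 0 δ, Λ (T σ f) = ∫ r in (c - σ)..(d - σ), U t (P r) y := by
    intro σ hσ
    rw [hΛ, ← intervalIntegral.integral_comp_sub_right (fun r => U t (P r) y),
      intervalIntegral.integral_of_le hcd.le]
    refine integral_congr_ae ?_
    have hfg : ∀ᵐ r ∂volume, r - σ ∈ I → f (r - σ) = g (r - σ) :=
      (measurePreserving_sub_right volume σ).quasiMeasurePreserving.ae ((ae_restrict_iff' hImeas).1 hF.1)
    filter_upwards [hac.ae_eq (hT_eq σ hσ.1 f), ae_restrict_mem measurableSet_Ioc,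
      ae_restrict_of_ae hfg] with r hr hrcd hfr
    have h1 : r - σ ∈ Icc (c - δ) (d + δ) :=
      ⟨by linarith [hrcd.1, hσ.2], by linarith [hrcd.2, hσ.1]⟩
    have h2 : r - σ ∈ Icc s t := ⟨by linarith [h1.1], by linarith [h1.2]⟩
    have h3 : r ∈ Icc s t := ⟨by linarith [hrcd.1], by linarith [hrcd.2]⟩
    rw [hr, if_pos (hstI h2), hfr (hstI h2), hg _ h1, hP r h3, hP _ h2,
      ← hU_comp t ht r (hstI h3) (r - σ) (hstI h2) (by linarith [hσ.1]) h3.2]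
    rfl
  have hder2 : HasDerivWithinAt (fun σ => Λ (T σ f)) (U t (P c) y - U t (P d) y) (Ici 0) 0 := by
    have hprim : ∀ x, HasDerivAt (fun x => ∫ r in s..x, U t (P r) y) (U t (P x) y) x := fun x =>
      intervalIntegral.integral_hasDerivAt_right (hW.intervalIntegrable _ _)
        (hW.stronglyMeasurableAtFilter _ _) hW.continuousAt
    have hc : ∀ x, HasDerivAt (fun σ => ∫ r in s..(x - σ), U t (P r) y) (-(U t (P x) y)) 0 := by
      intro x
      have h1 : HasDerivAt (fun σ : ℝ => x - σ) (-1) 0 := by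
        simpa using (hasDerivAt_id (0 : ℝ)).const_sub x
      have h2 := HasDerivAt.scomp (0 : ℝ) (by simpa using hprim x :
        HasDerivAt (fun x => ∫ r in s..x, U t (P r) y) (U t (P x) y) (x - 0)) h1
      simpa [Function.comp_def] using h2
    have h3 := (hc d).sub (hc c)
    have h4 : HasDerivAt (fun σ => ∫ r in (c - σ)..(d - σ), U t (P r) y)
        (U t (P c) y - U t (P d) y) 0 := by
      convert h3 using 1
      · ext σ
        rw [Pi.sub_apply, intervalIntegral.integral_interval_sub_left
          (hW.intervalIntegrable _ _) (hW.intervalIntegrable _ _)]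
      · abel
    refine (h4.hasDerivWithinAt (s := Ici 0)).congr_of_eventuallyEq ?_
      (hΛT 0 ⟨le_rfl, hδ.le⟩)
    filter_upwards [Icc_mem_nhdsGE hδ] with σ hσ using hΛT σ hσ
  have huniq := (uniqueDiffOn_Ici (0 : ℝ) 0 self_mem_Ici).eq_deriv _ hder2 hder
  rw [← hΛh, ← huniq, hP c ⟨by linarith, by linarith⟩, hP d ⟨by linarith, by linarith⟩]

omit [CompleteSpace X] in
theorem evolution_sub_eq_integral {I : Set ℝ} (hI : I.OrdConnected)
    {Aop : ℝ → X → X} {U : ℝ → ℝ → X →L[ℝ] X}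
    (hU_id : ∀ t ∈ I, U t t = 1)
    (hU_cont : ∀ x : X, ContinuousOn (fun q : ℝ × ℝ => U q.1 q.2 x)
      {q : ℝ × ℝ | q.1 ∈ I ∧ q.2 ∈ I ∧ q.2 ≤ q.1})
    (hU_bound : ∃ M' ω'' : ℝ, 1 ≤ M' ∧ ∀ t ∈ I, ∀ s ∈ I, s ≤ t →
      ‖U t s‖ ≤ M' * exp (ω'' * (t - s)))
    {y : X} (hA : ContinuousOn (fun t => Aop t y) I)
    (hlt : ∀ s c d t : ℝ, s ∈ I → t ∈ I → s < c → c < d → d < t →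
      U t c y - U t d y = ∫ r in c..d, U t r (Aop r y))
    {s t : ℝ} (hs : s ∈ I) (ht : t ∈ I) (hst : s ≤ t) :
    U t s y - y = ∫ r in s..t, U t r (Aop r y) := by
  rcases hst.eq_or_lt with rfl | hst'
  · simp [hU_id s hs]
  have hstI : Icc s t ⊆ I := hI.out hs ht
  let P : ℝ → ℝ := fun t' => projIcc s t hst t'
  have hPc : Continuous P := continuous_subtype_val.comp continuous_projIcc
  have hPI : ∀ r, P r ∈ I := fun r => hstI (projIcc _ _ hst r).2
  have hPt : ∀ r, P r ≤ t := fun r => (projIcc _ _ hst r).2.2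
  have hP : ∀ r ∈ Icc s t, P r = r := fun r hr => by simp [P, projIcc_of_mem hst hr]
  have hW : Continuous fun r => U t (P r) y := by
    rw [← continuousOn_univ]
    exact ContinuousOn.evolution_apply hU_cont hU_bound continuousOn_const (by fun_prop)
      (by fun_prop) (fun _ _ => ht) (fun _ _ => hPI _) (fun _ _ => hPt _)
  have hk : Continuous fun r => U t (P r) (Aop (P r) y) := by
    have : Continuous fun r => Aop (P r) y := hA.comp_continuous hPc hPI
    rw [← continuousOn_univ]
    exact ContinuousOn.evolution_apply hU_cont hU_bound continuousOn_const (by fun_prop)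
      this.continuousOn (fun _ _ => ht) (fun _ _ => hPI _) (fun _ _ => hPt _)
  have hkP : ∀ c d, c ∈ Icc s t → d ∈ Icc s t →
      ∫ r in c..d, U t r (Aop r y) = ∫ r in c..d, U t (P r) (Aop (P r) y) := by
    intro c d hc hd
    refine intervalIntegral.integral_congr fun r hr => ?_
    simp only [hP r (ordConnected_Icc.uIcc_subset hc hd hr)]
  have hprim : Continuous fun x => ∫ r in s..x, U t (P r) (Aop (P r) y) :=
    intervalIntegral.continuous_primitive (fun _ _ => hk.intervalIntegrable _ _) s
  let F : ℝ → X := fun ε => U t (P (s + ε)) y - U t (P (t - ε)) y -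
    ((∫ r in s..(t - ε), U t (P r) (Aop (P r) y)) -
      ∫ r in s..(s + ε), U t (P r) (Aop (P r) y))
  have hF : Continuous F :=
    ((hW.comp (continuous_const.add continuous_id)).sub
      (hW.comp (continuous_const.sub continuous_id))).sub
      ((hprim.comp (continuous_const.sub continuous_id)).sub
        (hprim.comp (continuous_const.add continuous_id)))
  have hF0 : ∀ᶠ ε in 𝓝[>] (0 : ℝ), F ε = 0 := by
    filter_upwards [Ioo_mem_nhdsGT (show (0 : ℝ) < (t - s) / 2 by linarith)] with ε hε
    have hc : s + ε ∈ Icc s t := ⟨by linarith [hε.1], by linarith [hε.2]⟩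
    have hd : t - ε ∈ Icc s t := ⟨by linarith [hε.2], by linarith [hε.1]⟩
    simp only [F]
    rw [intervalIntegral.integral_interval_sub_left (hk.intervalIntegrable _ _)
      (hk.intervalIntegrable _ _), ← hkP _ _ hc hd, hP _ hc, hP _ hd,
      hlt s (s + ε) (t - ε) t hs ht (by linarith [hε.1]) (by linarith [hε.2])
        (by linarith [hε.1]), sub_self]
  have hlim : F 0 = 0 := tendsto_nhds_unique
    ((hF.tendsto 0).mono_left nhdsWithin_le_nhds)
    (tendsto_const_nhds.congr' (hF0.mono fun _ h => h.symm))
  simp only [F, add_zero, sub_zero, intervalIntegral.integral_same] at hlim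
  rw [hP s (left_mem_Icc.2 hst), hP t (right_mem_Icc.2 hst), hU_id t ht,
    ← hkP s t (left_mem_Icc.2 hst) (right_mem_Icc.2 hst), sub_eq_zero] at hlim
  exact hlim

/-- The evolution of an invertible family, extended below the diagonal by inverses. -/
noncomputable def invertibleExtension (U : ℝ → ℝ → X →L[ℝ] X) (t s : ℝ) : X →L[ℝ] X :=
  if s ≤ t then U t s else Ring.inverse (U s t)

section Extension

variable {U : ℝ → ℝ → X →L[ℝ] X}

omit [CompleteSpace X] in
theorem invertibleExtension_eq_inverse_mul
    (hU_comp : ∀ t r s : ℝ, s ≤ r → r ≤ t → U t r * U r s = U t s)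
    (hU_unit : ∀ t s : ℝ, s ≤ t → IsUnit (U t s)) {t s b : ℝ} (htb : t ≤ b) (hsb : s ≤ b) :
    invertibleExtension U t s = Ring.inverse (U b t) * U b s := by
  unfold invertibleExtension
  split_ifs with h
  · rw [← hU_comp b t s h htb, ← mul_assoc, Ring.inverse_mul_cancel _ (hU_unit b t htb), one_mul]
  · have hts : t ≤ s := (not_le.1 h).le
    calc Ring.inverse (U s t) = Ring.inverse (U b t) * (U b s * U s t) * Ring.inverse (U s t) := by
          rw [hU_comp b s t hts hsb, Ring.inverse_mul_cancel _ (hU_unit b t htb), one_mul]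
      _ = _ := by
          rw [mul_assoc, mul_assoc, Ring.mul_inverse_cancel _ (hU_unit s t hts), mul_one]

omit [CompleteSpace X] in
theorem invertibleExtension_eq_mul_inverse
    (hU_comp : ∀ t r s : ℝ, s ≤ r → r ≤ t → U t r * U r s = U t s)
    (hU_unit : ∀ t s : ℝ, s ≤ t → IsUnit (U t s)) {t s a : ℝ} (hat : a ≤ t) (has : a ≤ s) :
    invertibleExtension U t s = U t a * Ring.inverse (U s a) := by
  unfold invertibleExtension
  split_ifs with h
  · rw [← hU_comp t s a has h, mul_assoc, Ring.mul_inverse_cancel _ (hU_unit s a has), mul_one]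
  · have hts : t ≤ s := (not_le.1 h).le
    calc Ring.inverse (U s t) = Ring.inverse (U s t) * (U s t * U t a * Ring.inverse (U s a)) := by
          rw [hU_comp s t a hat hts, Ring.mul_inverse_cancel _ (hU_unit s a has), mul_one]
      _ = _ := by
          rw [← mul_assoc, ← mul_assoc, Ring.inverse_mul_cancel _ (hU_unit s t hts), one_mul]

omit [CompleteSpace X] in
theorem invertibleExtension_mul_cancel (hU_id : ∀ t, U t t = 1)
    (hU_unit : ∀ t s : ℝ, s ≤ t → IsUnit (U t s)) (t s : ℝ) :
    invertibleExtension U t s * invertibleExtension U s t = 1 := by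
  unfold invertibleExtension
  rcases lt_trichotomy s t with h | rfl | h
  · rw [if_pos h.le, if_neg h.not_ge, Ring.mul_inverse_cancel _ (hU_unit t s h.le)]
  · simp [hU_id]
  · rw [if_neg h.not_ge, if_pos h.le, Ring.inverse_mul_cancel _ (hU_unit s t h.le)]

omit [CompleteSpace X] in
theorem hasDerivAt_invertibleExtension_right
    (hU_comp : ∀ t r s : ℝ, s ≤ r → r ≤ t → U t r * U r s = U t s)
    (hU_unit : ∀ t s : ℝ, s ≤ t → IsUnit (U t s)) {y z : X} {s : ℝ}
    (hder : ∀ t, s ≤ t → HasDerivWithinAt (fun σ => U t σ y) (-(U t s z)) (Iic t) s) (t : ℝ) :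
    HasDerivAt (fun σ => invertibleExtension U t σ y) (-(invertibleExtension U t s z)) s := by
  obtain ⟨b, htb, hsb⟩ : ∃ b, t ≤ b ∧ s < b :=
    ⟨max t s + 1, by linarith [le_max_left t s], by linarith [le_max_right t s]⟩
  have h1 : HasDerivAt (fun σ => U b σ y) (-(U b s z)) s :=
    (hder b hsb.le).hasDerivAt (Iic_mem_nhds hsb)
  have h2 := (Ring.inverse (U b t)).hasFDerivAt.comp_hasDerivAt s h1
  rw [map_neg, ← mul_apply_eq_comp,
    ← invertibleExtension_eq_inverse_mul hU_comp hU_unit htb hsb.le] at h2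
  refine h2.congr_of_eventuallyEq ?_
  filter_upwards [Iic_mem_nhds hsb] with σ hσ
  rw [invertibleExtension_eq_inverse_mul hU_comp hU_unit htb hσ]
  rfl

omit [CompleteSpace X] in
theorem hasDerivAt_invertibleExtension_left (hU_id : ∀ t, U t t = 1)
    (hU_comp : ∀ t r s : ℝ, s ≤ r → r ≤ t → U t r * U r s = U t s)
    (hU_unit : ∀ t s : ℝ, s ≤ t → IsUnit (U t s))
    (hU_cont : ∀ x : X, ContinuousOn (fun q : ℝ × ℝ => U q.1 q.2 x)
      {q : ℝ × ℝ | q.1 ∈ univ ∧ q.2 ∈ univ ∧ q.2 ≤ q.1})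
    (hU_bound : ∃ M' ω'' : ℝ, 1 ≤ M' ∧ ∀ t ∈ univ, ∀ s ∈ univ, s ≤ t →
      ‖U t s‖ ≤ M' * exp (ω'' * (t - s))) {y z : X} {s : ℝ}
    (hder : HasDerivAt (fun σ => invertibleExtension U s σ y) (-z) s) :
    HasDerivAt (fun τ => invertibleExtension U τ s y) z s := by
  have hss : invertibleExtension U s s = 1 := by simp [invertibleExtension, hU_id]
  have hs1 : s - 1 < s := by linarith
  rw [hasDerivAt_iff_tendsto_slope] at hder ⊢
  have h1 : Tendsto (fun τ => U τ (s - 1) (Ring.inverse (U s (s - 1))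
      (-slope (fun σ => invertibleExtension U s σ y) s τ))) (𝓝[≠] s)
      (𝓝 (U s (s - 1) (Ring.inverse (U s (s - 1)) (- -z)))) := by
    refine tendsto_evolution_apply hU_cont hU_bound
      ((continuous_id.tendsto s).mono_left nhdsWithin_le_nhds) tendsto_const_nhds
      (((Ring.inverse (U s (s - 1))).continuous.tendsto _).comp hder.neg)
      ⟨mem_univ _, mem_univ _, hs1.le⟩ ?_
    filter_upwards [mem_nhdsWithin_of_mem_nhds (Ici_mem_nhds hs1)] with τ hτ
    exact ⟨mem_univ _, mem_univ _, hτ⟩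
  rw [← mul_apply_eq_comp, Ring.mul_inverse_cancel _ (hU_unit _ _ hs1.le), neg_neg,
    one_apply_eq_self] at h1
  refine h1.congr' ?_
  filter_upwards [mem_nhdsWithin_of_mem_nhds (Ici_mem_nhds hs1)] with τ hτ
  have h2 : invertibleExtension U τ s (invertibleExtension U s τ y) = y := by
    rw [← mul_apply_eq_comp, invertibleExtension_mul_cancel hU_id hU_unit,
      one_apply_eq_self]
  rw [← mul_apply_eq_comp,
    ← invertibleExtension_eq_mul_inverse hU_comp hU_unit hτ hs1.le]
  simp only [slope_def_module, hss, one_apply_eq_self, map_neg, map_smul, map_sub, h2]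
  rw [← smul_neg, neg_sub]

end Extension

/-- **Differentiability of the evolution family (Theorem 3.12).**
Under the assumptions of the generation theorem (Kato-stable `A(t)` with
strongly continuous resolvents, `F_p` dense in `E_p` and `C_0(I,X)`, and
`U(·,·)` the evolution family whose evolution semigroup is generated by the
closure of `G₀ = −d/dt + A(·)`), if `Y ⊆ D(A(t))` for all `t ∈ I` and
`t ↦ A(t)y` is continuous for `y ∈ Y`, then `∂/∂s U(t,s)y = −U(t,s)A(s)y`
and `∂⁺/∂t U(t,s)y|_{t=s} = A(s)y` for `(t,s) ∈ D_I`, `y ∈ Y`.  If `I = ℝ`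
and `U(·,·)` is invertible one may take `t,s ∈ ℝ` and two-sided
derivatives. -/
theorem evolution_family_differentiability
    (I : Set ℝ) (hI : I.OrdConnected) (hImeas : MeasurableSet I)
    (Dom : ℝ → Set X) (Aop : ℝ → X → X)
    (hdense : ∀ t ∈ I, Dense (Dom t))
    (M ω : ℝ) (hM : 1 ≤ M)
    (Res : ℝ → ℝ → X →L[ℝ] X)
    (hRes_mem : ∀ t ∈ I, ∀ lam : ℝ, ω < lam → ∀ x : X,
      Res lam t x ∈ Dom t ∧ lam • Res lam t x - Aop t (Res lam t x) = x)
    (hRes_inv : ∀ t ∈ I, ∀ lam : ℝ, ω < lam → ∀ y ∈ Dom t,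
      Res lam t (lam • y - Aop t y) = y)
    (hstable : ∀ (k : ℕ) (ts : Fin k → ℝ), (∀ i, ts i ∈ I) → Monotone ts →
      ∀ lam : ℝ, ω < lam →
        ‖((List.ofFn fun i => Res lam (ts i)).reverse).prod‖
          ≤ M * ((lam - ω) ^ k)⁻¹)
    (ω' : ℝ) (hω' : ω < ω')
    (hRes_cont : ∀ x : X, ContinuousOn (fun t => Res ω' t x) I)
    (p : ℝ≥0∞) [Fact (1 ≤ p)] (hp : p ≠ ∞)
    (hrange : ∀ h : Lp X p (volume.restrict I), ∀ ε : ℝ, 0 < ε →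
      ∃ (f q : Lp X p (volume.restrict I)) (g g' af : ℝ → X),
        MemFp I Dom Aop p f g g' af ∧
        (⇑q =ᵐ[volume.restrict I] fun t => ω' • g t + g' t - af t) ∧
        ‖h - q‖ < ε)
    (hFp_dense : ∀ h : Lp X p (volume.restrict I), ∀ ε : ℝ, 0 < ε →
      ∃ (f : Lp X p (volume.restrict I)) (g g' af : ℝ → X),
        MemFp I Dom Aop p f g g' af ∧ ‖h - f‖ < ε)
    (hFp_dense_sup : ∀ k : ℝ → X, Continuous k → (∀ t ∉ I, k t = 0) →
      Tendsto k (cocompact ℝ) (𝓝 0) → ∀ ε : ℝ, 0 < ε →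
      ∃ (f : Lp X p (volume.restrict I)) (g g' af : ℝ → X),
        MemFp I Dom Aop p f g g' af ∧ ∀ t : ℝ, ‖g t - k t‖ ≤ ε)
    -- `U` is the resulting evolution family, `T` its evolution semigroup,
    -- whose generator is the closure of `G₀`
    (U : ℝ → ℝ → X →L[ℝ] X)
    (T : ℝ → (Lp X p (volume.restrict I) →L[ℝ] Lp X p (volume.restrict I)))
    (hU_id : ∀ t ∈ I, U t t = 1)
    (hU_comp : ∀ t ∈ I, ∀ r ∈ I, ∀ s ∈ I, s ≤ r → r ≤ t →
      (U t r).comp (U r s) = U t s)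
    (hU_cont : ∀ x : X, ContinuousOn (fun q : ℝ × ℝ => U q.1 q.2 x)
      {q : ℝ × ℝ | q.1 ∈ I ∧ q.2 ∈ I ∧ q.2 ≤ q.1})
    (hU_bound : ∃ M' ω'' : ℝ, 1 ≤ M' ∧ ∀ t ∈ I, ∀ s ∈ I, s ≤ t →
      ‖U t s‖ ≤ M' * exp (ω'' * (t - s)))
    (hT_eq : ∀ σ : ℝ, 0 ≤ σ → ∀ f : Lp X p (volume.restrict I),
      ⇑(T σ f) =ᵐ[volume.restrict I]
        fun t => if t - σ ∈ I then U t (t - σ) (f (t - σ)) else 0)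
    (hT_zero : T 0 = 1)
    (hT_sg : ∀ σ τ : ℝ, 0 ≤ σ → 0 ≤ τ → T (σ + τ) = (T σ).comp (T τ))
    (hT_cont : ∀ f, ContinuousOn (fun σ => T σ f) (Ici (0:ℝ)))
    (hG0 : ∀ (f : Lp X p (volume.restrict I)) (g g' af : ℝ → X),
      MemFp I Dom Aop p f g g' af →
      ∀ h : Lp X p (volume.restrict I),
        (⇑h =ᵐ[volume.restrict I] fun t => -(g' t) + af t) →
        HasDerivWithinAt (fun σ => T σ f) h (Ici (0:ℝ)) 0)
    -- the subspace `Y`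
    (Y : Set X) (hY : ∀ t ∈ I, Y ⊆ Dom t)
    (hAY_cont : ∀ y ∈ Y, ContinuousOn (fun t => Aop t y) I) :
    -- `∂/∂s U(t,s)y = −U(t,s)A(s)y` on `D_I`
    (∀ y ∈ Y, ∀ t ∈ I, ∀ s ∈ I, s ≤ t →
      HasDerivWithinAt (fun σ => U t σ y) (-(U t s (Aop s y)))
        (I ∩ Iic t) s) ∧
    -- `∂⁺/∂t U(t,s)y|_{t=s} = A(s)y`
    (∀ y ∈ Y, ∀ s ∈ I,
      HasDerivWithinAt (fun τ => U τ s y) (Aop s y) (I ∩ Ici s) s) ∧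
    -- the invertible case on `I = ℝ`, with `U(t,s) := U(s,t)⁻¹` for `t < s`
    (I = univ →
      (∀ t s : ℝ, s ≤ t → Function.Bijective (U t s)) →
      (∀ y ∈ Y, ∀ t s : ℝ,
        HasDerivAt
          (fun σ => (if σ ≤ t then U t σ else Ring.inverse (U σ t)) y)
          (-((if s ≤ t then U t s else Ring.inverse (U s t)) (Aop s y))) s) ∧
      (∀ y ∈ Y, ∀ s : ℝ,
        HasDerivAt
          (fun τ => (if s ≤ τ then U τ s else Ring.inverse (U s τ)) y)
          (Aop s y) s)) := by
  have hsmul : ∀ y ∈ Y, ∀ t ∈ I, ∀ r : ℝ, r • y ∈ Dom t ∧ Aop t (r • y) = r • Aop t y := by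
    intro y hy t ht r
    have h1 := hRes_inv t ht ω' hω' y (hY t ht hy)
    have h2 := hRes_mem t ht ω' hω' (r • (ω' • y - Aop t y))
    rw [map_smul, h1] at h2
    refine ⟨h2.1, ?_⟩
    rw [sub_eq_iff_eq_add, ← sub_eq_iff_eq_add'] at h2
    rw [← h2.2]
    module
  have hkey : ∀ y ∈ Y, ∀ t ∈ I, ∀ s ∈ I, s ≤ t →
      U t s y - y = ∫ r in s..t, U t r (Aop r y) := fun y hy t ht s hs hst =>
    evolution_sub_eq_integral hI hU_id hU_cont hU_bound (hAY_cont y hy)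
      (fun _ _ _ _ hs ht => evolution_sub_eq_integral_of_lt hI hImeas hU_comp hU_cont hU_bound
        hT_eq hG0 (hsmul y hy) (hAY_cont y hy) hs ht) hs ht hst
  have hleft : ∀ y ∈ Y, ∀ t ∈ I, ∀ s ∈ I, s ≤ t →
      HasDerivWithinAt (fun σ => U t σ y) (-(U t s (Aop s y))) (I ∩ Iic t) s := by
    intro y hy t ht s hs hst
    have hS : (I ∩ Iic t).OrdConnected := hI.inter ordConnected_Iic
    have hk : ContinuousOn (fun r => U t r (Aop r y)) (I ∩ Iic t) :=
      ContinuousOn.evolution_apply hU_cont hU_bound continuousOn_const continuousOn_id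
        ((hAY_cont y hy).mono inter_subset_left) (fun _ _ => ht) (fun _ h => h.1) (fun _ h => h.2)
    have h_int : ∀ a ∈ I ∩ Iic t, ∀ b ∈ I ∩ Iic t,
        IntervalIntegrable (fun r => U t r (Aop r y)) volume a b := fun a ha b hb =>
      (hk.mono (hS.uIcc_subset ha hb)).intervalIntegrable
    refine hasDerivWithinAt_of_sub_eq_integral hS hk.neg ⟨hs, hst⟩ fun x hx => ?_
    have h1 := intervalIntegral.integral_add_adjacent_intervals (h_int s ⟨hs, hst⟩ x hx)
      (h_int x hx t ⟨ht, self_mem_Iic⟩)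
    rw [← hkey y hy t ht x hx.1 hx.2, ← hkey y hy t ht s hs hst, ← eq_sub_iff_add_eq] at h1
    simp only [Pi.neg_apply]
    rw [intervalIntegral.integral_neg, h1]
    abel
  refine ⟨hleft, fun y hy s hs => ?_, ?_⟩
  · rw [hasDerivWithinAt_iff_isLittleO, Asymptotics.isLittleO_iff]
    intro ε hε
    have hk : ContinuousOn (fun q : ℝ × ℝ => U q.1 q.2 (Aop q.2 y))
        {q : ℝ × ℝ | q.1 ∈ I ∧ q.2 ∈ I ∧ q.2 ≤ q.1} :=
      ContinuousOn.evolution_apply hU_cont hU_bound continuousOn_fst continuousOn_snd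
        ((hAY_cont y hy).comp continuousOn_snd fun _ h => h.2.1)
        (fun _ h => h.1) (fun _ h => h.2.1) (fun _ h => h.2.2)
    obtain ⟨δ, hδ, hkδ⟩ := Metric.continuousWithinAt_iff.1 (hk (s, s) ⟨hs, hs, le_rfl⟩) ε hε
    filter_upwards [self_mem_nhdsWithin, mem_nhdsWithin_of_mem_nhds (Metric.ball_mem_nhds s hδ)]
      with x hx hxδ
    have hsx : Icc s x ⊆ I := hI.out hs hx.1
    have h_int : IntervalIntegrable (fun r => U x r (Aop r y)) volume s x := by
      refine ContinuousOn.intervalIntegrable ?_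
      rw [uIcc_of_le hx.2]
      exact hk.comp (f := fun r => (x, r)) (by fun_prop) fun r hr => ⟨hx.1, hsx hr, hr.2⟩
    have h1 : U x s y - U s s y - (x - s) • Aop s y
        = ∫ r in s..x, (U x r (Aop r y) - Aop s y) := by
      rw [intervalIntegral.integral_sub h_int (by simp), intervalIntegral.integral_const, hU_id s hs,
        one_apply_eq_self, hkey y hy x hx.1 s hs hx.2]
    rw [h1]
    refine intervalIntegral.norm_integral_le_of_norm_le_const fun r hr => ?_
    rw [uIoc_of_le hx.2] at hr
    have h2 := hkδ (x := (x, r)) ⟨hx.1, hsx ⟨hr.1.le, hr.2⟩, hr.2⟩ (by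
      rw [Metric.mem_ball, Real.dist_eq, abs_lt] at hxδ
      rw [Prod.dist_eq, max_lt_iff, Real.dist_eq, Real.dist_eq, abs_lt, abs_lt]
      exact ⟨hxδ, by linarith [hr.1], by linarith [hr.2, hxδ.2]⟩)
    rw [dist_eq_norm, hU_id s hs, one_apply_eq_self] at h2
    exact h2.le
  · rintro rfl hbij
    have hU_unit : ∀ t s : ℝ, s ≤ t → IsUnit (U t s) := fun t s hst =>
      ContinuousLinearMap.isUnit_iff_bijective.2 (hbij t s hst)
    have hcomp : ∀ t r s : ℝ, s ≤ r → r ≤ t → U t r * U r s = U t s := fun t r s =>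
      hU_comp t (mem_univ _) r (mem_univ _) s (mem_univ _)
    have hright : ∀ y ∈ Y, ∀ t s : ℝ, HasDerivAt (fun σ => invertibleExtension U t σ y)
        (-(invertibleExtension U t s (Aop s y))) s := fun y hy t s =>
      hasDerivAt_invertibleExtension_right hcomp hU_unit (fun t hst => by
        simpa using hleft y hy t (mem_univ _) s (mem_univ _) hst) t
    refine ⟨hright, fun y hy s => ?_⟩
    refine hasDerivAt_invertibleExtension_left (fun t => hU_id t (mem_univ _)) hcomp hU_unit
      hU_cont hU_bound ?_
    simpa [invertibleExtension, hU_id s (mem_univ _)] using hright y hy s s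
end

section
/- Suppose the assumptions of the closure theorem hold with I = ℝ (A(t) Kato-stable with strongly continuous resolvent, (ω'−G₀)F_p dense in E_p, F_p dense in E_p and C_0(ℝ,X)) and that the resulting evolution family U(·,·) is invertible. Then for every s ∈ ℝ and x ∈ X, u = U(·,s)x ∈ C(ℝ,X) is the unique (E_p)-mild solution on ℝ of the nonautonomous Cauchy problem u'(t) = A(t)u(t), u(s) = x. Moreover, u is the only function in C(ℝ,X) with u(s) = x such that ψ_d u ∈ D(G) and G(ψ_d u) = 0 on [−d,d] for all d > |s|, where ψ_d ∈ C¹_c(ℝ) satisfies 0 ≤ ψ_d ≤ 1 and ψ_d = 1 on [−d,d]. -/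
open MeasureTheory Set Real Filter
open scoped ENNReal Topology Classical

variable {X : Type*} [NormedAddCommGroup X] [NormedSpace ℝ X] [CompleteSpace X]

/-- A function `g` (with derivative `g'` and `A(·)g(·) = af`) belonging to
`F_p = W^{1,p}_0(ℝ,X) ∩ D(A(·))`. -/
def MemFpFunR (Dom : ℝ → Set X) (Aop : ℝ → X → X) (p : ℝ≥0∞)
    (g g' af : ℝ → X) : Prop :=
  Continuous g ∧ Tendsto g (cocompact ℝ) (𝓝 0) ∧
  (∀ s t : ℝ, g t - g s = ∫ τ in s..t, g' τ) ∧
  MemLp g' p (volume : Measure ℝ) ∧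
  (∀ᵐ t ∂(volume : Measure ℝ), g t ∈ Dom t ∧ af t = Aop t (g t)) ∧
  MemLp af p (volume : Measure ℝ)

/-- `u` is an `(E_p)`-mild solution on `ℝ` of `u' = A(·)u`, `u(s) = x`. -/
def IsMildSolR (s : ℝ) (Dom : ℝ → Set X) (Aop : ℝ → X → X) (p : ℝ≥0∞)
    (x : X) (u : ℝ → X) : Prop :=
  Continuous u ∧ u s = x ∧
  ∀ d : ℝ, |s| < d → ∃ un un' an : ℕ → ℝ → X,
    (∀ n : ℕ,
      (∀ t₁ ∈ Icc (-d) d, ∀ t₂ ∈ Icc (-d) d,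
        un n t₂ - un n t₁ = ∫ τ in t₁..t₂, un' n τ) ∧
      MemLp (un' n) p (volume.restrict (Icc (-d) d)) ∧
      (∀ᵐ t ∂(volume.restrict (Icc (-d) d)),
        un n t ∈ Dom t ∧ an n t = Aop t (un n t)) ∧
      MemLp (an n) p (volume.restrict (Icc (-d) d))) ∧
    (∀ ε : ℝ, 0 < ε → ∃ N : ℕ, ∀ n ≥ N, ∀ t ∈ Icc (-d) d,
      ‖un n t - u t‖ ≤ ε) ∧
    Tendsto (fun n : ℕ =>
        eLpNorm (fun t => -(un' n t) + an n t) p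
          (volume.restrict (Icc (-d) d)))
      atTop (𝓝 0)

/-- The product rule, in integrated form, for a `C¹` scalar function and a primitive of a locally
integrable vector-valued function. -/
theorem smul_sub_smul_eq_integral_of_primitive {φ : ℝ → ℝ} (hφ : ContDiff ℝ 1 φ) {e e' : ℝ → X}
    (he' : ∀ a b, IntervalIntegrable e' volume a b)
    (he : ∀ a b, e b - e a = ∫ τ in a..b, e' τ) (a b : ℝ) :
    φ b • e b - φ a • e a = ∫ τ in a..b, (deriv φ τ • e τ + φ τ • e' τ) := by
  have hec : Continuous e := by
    have : e = fun t => e a + ∫ τ in a..t, e' τ := by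
      funext t; rw [← he a t]; abel
    rw [this]
    exact continuous_const.add (intervalIntegral.continuous_primitive he' a)
  have hdc : Continuous (deriv φ) := hφ.continuous_deriv le_rfl
  have hint : IntervalIntegrable (fun τ => deriv φ τ • e τ + φ τ • e' τ) volume a b :=
    ((hdc.smul hec).intervalIntegrable a b).add ((he' a b).continuousOn_smul hφ.continuous.continuousOn)
  refine (SeparatingDual.eq_iff_forall_dual_eq (R := ℝ)).2 fun l => ?_
  rw [← ContinuousLinearMap.intervalIntegral_comp_comm l hint]
  have hli : IntervalIntegrable (fun τ => l (e' τ)) volume a b :=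
    ⟨l.integrable_comp (he' a b).1, l.integrable_comp (he' a b).2⟩
  have hle : (fun t => l (e t)) = fun t => l (e a) + ∫ τ in a..t, l (e' τ) := by
    funext t
    rw [ContinuousLinearMap.intervalIntegral_comp_comm l (he' a t), ← he a t, ← map_add]
    congr 1; abel
  have hac : AbsolutelyContinuousOnInterval (fun t => l (e t)) a b := by
    rw [hle]
    exact (contDiff_const (c := l (e a))).contDiffOn.absolutelyContinuousOnInterval.add
      (hli.absolutelyContinuousOnInterval_intervalIntegral left_mem_uIcc)
  have hprod := hφ.contDiffOn.absolutelyContinuousOnInterval.integral_deriv_mul_eq_sub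
    (a := a) (b := b) hac
  simp only [map_sub, map_add, map_smul, smul_eq_mul]
  rw [← hprod]
  refine intervalIntegral.integral_congr_ae ?_
  filter_upwards [hli.ae_hasDerivAt_integral] with τ hτ hmem
  have h1 : HasDerivAt (fun t => l (e t)) (l (e' τ)) τ := by
    rw [hle]
    exact (hτ (uIoc_subset_uIcc hmem) a left_mem_uIcc).const_add _
  rw [h1.deriv]

/-- On a bounded interval the `L¹` norm is controlled by the `L^p` norm. -/
theorem exists_integral_norm_le_eLpNorm (p : ℝ≥0∞) (hp : 1 ≤ p) (a b : ℝ) :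
    ∃ K : ℝ, 0 ≤ K ∧ ∀ F : ℝ → X, MemLp F p (volume.restrict (Icc a b)) →
      ∫ τ in Icc a b, ‖F τ‖ ≤ K * (eLpNorm F p (volume.restrict (Icc a b))).toReal := by
  set μ : Measure ℝ := volume.restrict (Icc a b)
  have hr : 0 ≤ 1 / (1 : ℝ≥0∞).toReal - 1 / p.toReal := by
    rcases eq_or_ne p ∞ with rfl | hp'
    · simp
    · have : 1 ≤ p.toReal := by
        simpa using (ENNReal.toReal_le_toReal ENNReal.one_ne_top hp').2 hp
      have : 1 / p.toReal ≤ 1 := by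
        rw [div_le_one (by linarith)]; exact this
      simpa using this
  have hfin : μ univ ^ (1 / (1 : ℝ≥0∞).toReal - 1 / p.toReal) ≠ ∞ :=
    ENNReal.rpow_ne_top_of_nonneg hr (measure_ne_top _ _)
  refine ⟨(μ univ ^ (1 / (1 : ℝ≥0∞).toReal - 1 / p.toReal)).toReal, ENNReal.toReal_nonneg,
    fun F hF => ?_⟩
  have h := eLpNorm_le_eLpNorm_mul_rpow_measure_univ (μ := μ) hp hF.1
  rw [integral_norm_eq_lintegral_enorm hF.1, ← eLpNorm_one_eq_lintegral_enorm, mul_comm,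
    ← ENNReal.toReal_mul]
  exact ENNReal.toReal_mono (ENNReal.mul_ne_top hF.2.ne hfin) h

theorem exists_integral_norm_le_norm_Lp (p : ℝ≥0∞) (hp : 1 ≤ p) (a b : ℝ) :
    ∃ K : ℝ, 0 ≤ K ∧ ∀ F : Lp X p (volume : Measure ℝ), ∫ τ in Icc a b, ‖F τ‖ ≤ K * ‖F‖ := by
  obtain ⟨K, hK, h⟩ := exists_integral_norm_le_eLpNorm (X := X) p hp a b
  refine ⟨K, hK, fun F => (h F ((Lp.memLp F).restrict _)).trans ?_⟩
  refine mul_le_mul_of_nonneg_left ?_ hK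
  rw [Lp.norm_def]
  exact ENNReal.toReal_mono (Lp.memLp F).2.ne (eLpNorm_mono_measure _ Measure.restrict_le_self)

theorem integrableOn_Lp {p : ℝ≥0∞} (hp : 1 ≤ p) (F : Lp X p (volume : Measure ℝ)) (a b : ℝ) :
    IntegrableOn F (Icc a b) :=
  ((Lp.memLp F).restrict _).integrable hp

theorem continuous_integral_norm_Lp (p : ℝ≥0∞) [Fact (1 ≤ p)] (a b : ℝ) :
    Continuous fun F : Lp X p (volume : Measure ℝ) => ∫ τ in Icc a b, ‖F τ‖ := by
  obtain ⟨K, hK, h⟩ := exists_integral_norm_le_norm_Lp (X := X) p Fact.out a b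
  refine (LipschitzWith.of_dist_le_mul (K := ⟨K, hK⟩) fun F G => ?_).continuous
  rw [dist_eq_norm, dist_eq_norm, ← integral_sub (integrableOn_Lp Fact.out F a b).norm
    (integrableOn_Lp Fact.out G a b).norm]
  refine le_trans ?_ (h (F - G))
  refine (norm_integral_le_integral_norm _).trans (integral_mono_ae ?_ ?_ ?_)
  · exact ((integrableOn_Lp Fact.out F a b).norm.sub (integrableOn_Lp Fact.out G a b).norm).norm
  · exact (integrableOn_Lp Fact.out (F - G) a b).norm
  · filter_upwards [ae_restrict_of_ae (Lp.coeFn_sub F G)] with τ hτ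
    rw [hτ]
    exact abs_norm_sub_norm_le _ _

/-- `T` is the evolution semigroup on `L^p(ℝ,X)` of the exponentially bounded evolution
family `U`. -/
structure IsEvolutionSemigroup {p : ℝ≥0∞} [Fact (1 ≤ p)] (U : ℝ → ℝ → X →L[ℝ] X)
    (T : ℝ → (Lp X p (volume : Measure ℝ) →L[ℝ] Lp X p (volume : Measure ℝ))) : Prop where
  self : ∀ t : ℝ, U t t = 1
  comp : ∀ t r s : ℝ, s ≤ r → r ≤ t → (U t r).comp (U r s) = U t s
  cont : ∀ x : X, ContinuousOn (fun q : ℝ × ℝ => U q.1 q.2 x) {q : ℝ × ℝ | q.2 ≤ q.1}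
  bound : ∃ M' ω'' : ℝ, 1 ≤ M' ∧ ∀ t s : ℝ, s ≤ t → ‖U t s‖ ≤ M' * exp (ω'' * (t - s))
  semigroup_eq : ∀ σ : ℝ, 0 ≤ σ → ∀ f : Lp X p (volume : Measure ℝ),
    ⇑(T σ f) =ᵐ[(volume : Measure ℝ)] fun t => U t (t - σ) (f (t - σ))
  zero : T 0 = 1

namespace IsEvolutionSemigroup

variable {p : ℝ≥0∞} [Fact (1 ≤ p)] {U : ℝ → ℝ → X →L[ℝ] X}
  {T : ℝ → (Lp X p (volume : Measure ℝ) →L[ℝ] Lp X p (volume : Measure ℝ))}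

theorem comp_apply (hE : IsEvolutionSemigroup U T) {t r s : ℝ} (hsr : s ≤ r) (hrt : r ≤ t)
    (x : X) : U t r (U r s x) = U t s x := by
  rw [← hE.comp t r s hsr hrt]; rfl

theorem exists_norm_le (hE : IsEvolutionSemigroup U T) (L : ℝ) :
    ∃ C : ℝ, 0 ≤ C ∧ ∀ t s : ℝ, s ≤ t → t - s ≤ L → ‖U t s‖ ≤ C := by
  obtain ⟨M', ω'', hM', h⟩ := hE.bound
  refine ⟨M' * exp (|ω''| * L), by positivity, fun t s hst hL => (h t s hst).trans ?_⟩
  refine mul_le_mul_of_nonneg_left (exp_le_exp.2 ?_) (by linarith)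
  calc ω'' * (t - s) ≤ |ω''| * (t - s) :=
        mul_le_mul_of_nonneg_right (le_abs_self _) (by linarith)
    _ ≤ |ω''| * L := mul_le_mul_of_nonneg_left hL (abs_nonneg _)

theorem continuous_apply (hE : IsEvolutionSemigroup U T) {a b : ℝ → ℝ} {g : ℝ → X}
    (ha : Continuous a) (hb : Continuous b) (hg : Continuous g) (hba : ∀ r, b r ≤ a r) :
    Continuous fun r => U (a r) (b r) (g r) := by
  refine continuous_iff_continuousAt.2 fun r₀ => ?_
  obtain ⟨C, hC0, hC⟩ := hE.exists_norm_le (a r₀ - b r₀ + 1)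
  have h1 : Continuous fun r => U (a r) (b r) (g r₀) :=
    (hE.cont (g r₀)).comp_continuous (ha.prodMk hb) hba
  have h2 : Tendsto (fun r => U (a r) (b r) (g r - g r₀)) (𝓝 r₀) (𝓝 0) := by
    have h3 : Tendsto (fun r => C * ‖g r - g r₀‖) (𝓝 r₀) (𝓝 0) := by
      have : Continuous fun r => C * ‖g r - g r₀‖ := by fun_prop
      simpa using this.tendsto r₀
    refine squeeze_zero_norm' ?_ h3
    have h4 : ∀ᶠ r in 𝓝 r₀, a r - b r < a r₀ - b r₀ + 1 :=
      (ha.sub hb).continuousAt.eventually_lt_const (by simp)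
    filter_upwards [h4] with r hr
    exact (U (a r) (b r)).le_of_opNorm_le (hC _ _ (hba r) hr.le) _
  have h5 := h2.add (h1.tendsto r₀)
  rw [zero_add] at h5
  refine h5.congr fun r => ?_
  simp

/-- If `f`, with continuous representative `g`, belongs to the domain of the generator, and `w` is
its image, then `g` solves the inhomogeneous problem up to an error controlled by `w`. -/
theorem norm_apply_sub_le (hE : IsEvolutionSemigroup U T)
    {f w : Lp X p (volume : Measure ℝ)} {g : ℝ → X} (hg : Continuous g)
    (hfg : ⇑f =ᵐ[(volume : Measure ℝ)] g)
    (hd : HasDerivWithinAt (fun σ => T σ f) w (Ici (0 : ℝ)) 0)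
    {a t C : ℝ} (hat : a ≤ t) (hC0 : 0 ≤ C) (hC : ∀ τ ∈ Icc a t, ‖U t τ‖ ≤ C) :
    ‖U t a (g a) - g t‖ ≤ C * ∫ τ in Icc a t, ‖w τ‖ := by
  set Φ : ℝ → X := fun τ => U t (min τ t) (g (min τ t)) with hΦdef
  have hΦ : Continuous Φ := hE.continuous_apply continuous_const
    (continuous_id.min continuous_const) (hg.comp (continuous_id.min continuous_const))
    fun r => min_le_right _ _
  have hΦa : Φ a = U t a (g a) := by simp [hΦdef, hat]
  have hΦt : Φ t = g t := by simp [hΦdef, hE.self]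
  set J : ℝ → X := fun σ => (∫ y in (0 : ℝ)..(t - σ), Φ y) - ∫ y in (0 : ℝ)..(a - σ), Φ y with hJ
  have hprim : ∀ c : ℝ, HasDerivAt (fun σ => ∫ y in (0 : ℝ)..(c - σ), Φ y) (-Φ c) 0 := by
    intro c
    have h1 : HasDerivAt (fun y => ∫ z in (0 : ℝ)..y, Φ z) (Φ (c - 0)) (c - 0) :=
      (hΦ.integral_hasStrictDerivAt 0 (c - 0)).hasDerivAt
    have h2 : HasDerivAt (fun σ : ℝ => c - σ) (-1) 0 := by
      simpa using (hasDerivAt_id (0 : ℝ)).const_sub c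
    have h3 := h1.scomp 0 h2
    rw [sub_zero, neg_one_smul] at h3
    exact h3
  have hJd : HasDerivAt J (Φ a - Φ t) 0 := by
    have := (hprim t).sub (hprim a)
    rwa [show -Φ t - -Φ a = Φ a - Φ t by abel] at this
  have hJt := (hasDerivWithinAt_iff_tendsto_slope' (s := Ioi (0 : ℝ)) (by simp)).1
    (hJd.hasDerivWithinAt (s := Ioi 0))
  have hTt := (hasDerivWithinAt_iff_tendsto_slope' (s := Ioi (0 : ℝ)) (by simp)).1
    (hd.mono Ioi_subset_Ici_self)
  have hN := (((continuous_integral_norm_Lp p a t).tendsto w).comp hTt).const_mul C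
  rw [← hΦa, ← hΦt]
  refine le_of_tendsto_of_tendsto hJt.norm hN ?_
  filter_upwards [self_mem_nhdsWithin] with σ hσ
  replace hσ : 0 < σ := hσ
  have hJσ : slope J 0 σ = ∫ τ in a..t, σ⁻¹ • (Φ (τ - σ) - Φ τ) := by
    have hi : ∀ c d : ℝ, IntervalIntegrable Φ volume c d := fun c d => hΦ.intervalIntegrable c d
    have hi' : IntervalIntegrable (fun τ => Φ (τ - σ)) volume a t :=
      (hΦ.comp (continuous_id.sub continuous_const)).intervalIntegrable a t
    rw [slope_def_module, intervalIntegral.integral_smul, intervalIntegral.integral_sub hi' (hi a t),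
      intervalIntegral.integral_comp_sub_right (fun τ => Φ τ) σ]
    simp only [hJ, sub_zero]
    rw [intervalIntegral.integral_interval_sub_left (hi _ _) (hi _ _),
      intervalIntegral.integral_interval_sub_left (hi _ _) (hi _ _)]
  have hslope : ∀ᵐ τ ∂(volume : Measure ℝ), (slope (fun σ => T σ f) 0 σ : Lp X p volume) τ =
      σ⁻¹ • (U τ (τ - σ) (g (τ - σ)) - g τ) := by
    have hsh : ∀ᵐ τ ∂(volume : Measure ℝ), f (τ - σ) = g (τ - σ) :=
      (measurePreserving_sub_right volume σ).quasiMeasurePreserving.ae hfg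
    have hsl : slope (fun σ => T σ f) 0 σ = σ⁻¹ • (T σ f - f) := by
      rw [slope_def_module, hE.zero, sub_zero]; rfl
    rw [hsl]
    filter_upwards [hsh, hfg, hE.semigroup_eq σ hσ.le f, Lp.coeFn_smul σ⁻¹ (T σ f - f),
      Lp.coeFn_sub (T σ f) f] with τ h1 h2 h3 h4 h5
    rw [h4, Pi.smul_apply, h5, Pi.sub_apply, h3, h2, h1]
  have hwi : IntegrableOn (fun τ => ‖(slope (fun σ => T σ f) 0 σ : Lp X p volume) τ‖) (Icc a t) :=
    (integrableOn_Lp Fact.out _ a t).norm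
  rw [Function.comp_apply, hJσ, integral_Icc_eq_integral_Ioc, ← intervalIntegral.integral_of_le hat,
    ← intervalIntegral.integral_const_mul]
  refine intervalIntegral.norm_integral_le_of_norm_le hat ?_
    (((intervalIntegrable_iff_integrableOn_Icc_of_le hat).2 hwi).const_mul C)
  filter_upwards [hslope] with τ hτ hmem
  have e1 : Φ τ = U t τ (g τ) := by simp [hΦdef, hmem.2]
  have e2 : Φ (τ - σ) = U t τ (U τ (τ - σ) (g (τ - σ))) := by
    rw [hE.comp_apply (by linarith) hmem.2]
    simp [hΦdef, min_eq_left (show τ - σ ≤ t by linarith [hmem.2])]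
  rw [hτ, e1, e2, ← map_sub, ← map_smul]
  exact (U t τ).le_of_opNorm_le (hC τ ⟨hmem.1.le, hmem.2⟩) _

/-- On bounded intervals, the graph norm of the generator controls the supremum norm. -/
theorem exists_norm_le_graph (hE : IsEvolutionSemigroup U T) (d : ℝ) :
    ∃ K : ℝ, 0 ≤ K ∧ ∀ (f w : Lp X p (volume : Measure ℝ)) (g : ℝ → X), Continuous g →
      ⇑f =ᵐ[(volume : Measure ℝ)] g →
      HasDerivWithinAt (fun σ => T σ f) w (Ici (0 : ℝ)) 0 →
      ∀ t ∈ Icc (-d) d, ‖g t‖ ≤ K * (‖f‖ + ‖w‖) := by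
  obtain ⟨C, hC0, hC⟩ := hE.exists_norm_le 1
  obtain ⟨K, hK0, hK⟩ := exists_integral_norm_le_norm_Lp (X := X) p Fact.out (-d - 1) d
  refine ⟨C * K, by positivity, fun f w g hg hfg hd t ht => ?_⟩
  have hsub : ∀ a ∈ Icc (t - 1) t, Icc a t ⊆ Icc (-d - 1) d := fun a ha =>
    Icc_subset_Icc (by linarith [ha.1, ht.1]) ht.2
  have hmono : ∀ (F : Lp X p (volume : Measure ℝ)), ∀ a ∈ Icc (t - 1) t,
      ∫ τ in Icc a t, ‖F τ‖ ≤ K * ‖F‖ := fun F a ha =>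
    (setIntegral_mono_set (integrableOn_Lp Fact.out F _ _).norm
      (Eventually.of_forall fun _ => norm_nonneg _) (hsub a ha).eventuallyLE).trans (hK F)
  have hpt : ∀ a ∈ Icc (t - 1) t, ‖g t‖ ≤ C * ‖g a‖ + C * (K * ‖w‖) := by
    intro a ha
    have h1 := hE.norm_apply_sub_le hg hfg hd ha.2 hC0
      fun τ hτ => hC t τ hτ.2 (by linarith [hτ.1, ha.1])
    have h2 : ‖U t a (g a)‖ ≤ C * ‖g a‖ :=
      (U t a).le_of_opNorm_le (hC t a ha.2 (by linarith [ha.1])) _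
    have h3 := mul_le_mul_of_nonneg_left (hmono w a ha) hC0
    have h4 : ‖g t‖ ≤ ‖U t a (g a)‖ + ‖U t a (g a) - g t‖ := by
      have := norm_sub_le (U t a (g a)) (U t a (g a) - g t)
      simpa using this
    linarith
  have hint : ∫ a in (t - 1)..t, (C * ‖g a‖ + C * (K * ‖w‖)) ≤ C * K * (‖f‖ + ‖w‖) := by
    have hCg : Continuous fun a => C * ‖g a‖ := continuous_const.mul hg.norm
    rw [intervalIntegral.integral_add (hCg.intervalIntegrable _ _)
      (continuous_const.intervalIntegrable _ _), intervalIntegral.integral_const_mul,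
      intervalIntegral.integral_const, intervalIntegral.integral_of_le (by linarith),
      ← integral_Icc_eq_integral_Ioc]
    have h5 : ∫ a in Icc (t - 1) t, ‖g a‖ = ∫ a in Icc (t - 1) t, ‖f a‖ :=
      integral_congr_ae (ae_restrict_of_ae (hfg.mono fun a ha => by simp only [ha]))
    rw [h5]
    have h6 := mul_le_mul_of_nonneg_left (hmono f (t - 1) ⟨le_rfl, by linarith⟩) hC0
    simp only [sub_sub_cancel, one_smul]
    linarith
  refine le_trans ?_ hint
  have h7 : ‖g t‖ = ∫ _ in (t - 1)..t, ‖g t‖ := by simp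
  rw [h7]
  refine intervalIntegral.integral_mono_on (by linarith) (by simp)
    (((continuous_const.mul hg.norm).add continuous_const).intervalIntegrable _ _) hpt

end IsEvolutionSemigroup

namespace IsEvolutionSemigroup

variable {p : ℝ≥0∞} [Fact (1 ≤ p)] {U : ℝ → ℝ → X →L[ℝ] X}
  {T : ℝ → (Lp X p (volume : Measure ℝ) →L[ℝ] Lp X p (volume : Measure ℝ))}

/-- The product of an orbit of `U` with a `C¹` cut-off function belongs to the domain of the
generator. -/
theorem hasDerivWithinAt_smul (hE : IsEvolutionSemigroup U T) {u : ℝ → X} (hu : Continuous u)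
    (hUu : ∀ a t, a ≤ t → U t a (u a) = u t) {ψ : ℝ → ℝ} (hψ : ContDiff ℝ 1 ψ)
    (hψc : HasCompactSupport ψ) {h w : Lp X p (volume : Measure ℝ)}
    (hh : ⇑h =ᵐ[(volume : Measure ℝ)] fun t => ψ t • u t)
    (hw : ⇑w =ᵐ[(volume : Measure ℝ)] fun t => -(deriv ψ t • u t)) :
    HasDerivWithinAt (fun σ => T σ h) w (Ici (0 : ℝ)) 0 := by
  obtain ⟨R, hR⟩ := hψc.isBounded.subset_closedBall (0 : ℝ)
  have hψ0 : ∀ t, R < |t| → ψ t = 0 := fun t ht => by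
    by_contra hne
    have := hR (subset_tsupport ψ hne)
    rw [mem_closedBall_zero_iff, norm_eq_abs] at this
    linarith
  have hψ'0 : ∀ t, R < |t| → deriv ψ t = 0 := fun t ht => by
    by_contra hne
    have := hR (support_deriv_subset hne)
    rw [mem_closedBall_zero_iff, norm_eq_abs] at this
    linarith
  let χ : ContDiffBump (0 : ℝ) := ⟨|R| + 1, |R| + 2, by positivity, by linarith⟩
  have hχu : MemLp (fun t => χ t • u t) p (volume : Measure ℝ) :=
    (χ.continuous.smul hu).memLp_of_hasCompactSupport χ.hasCompactSupport.smul_right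
  set B := hχu.toLp with hB
  rw [hasDerivWithinAt_iff_isLittleO, Asymptotics.isLittleO_iff]
  intro c hc
  set ε : ℝ := c / (‖B‖ + 1) with hε
  have hε0 : 0 < ε := by positivity
  have huc : UniformContinuous (deriv ψ) :=
    (hψ.continuous_deriv le_rfl).uniformContinuous_of_tendsto_cocompact
      hψc.deriv.is_zero_at_infty
  obtain ⟨δ, hδ, hδε⟩ := Metric.uniformContinuous_iff.1 huc ε hε0
  have hev : ∀ᶠ σ in 𝓝[Ici 0] (0 : ℝ), σ < min δ 1 :=
    nhdsWithin_le_nhds (Iio_mem_nhds (by positivity))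
  filter_upwards [hev, self_mem_nhdsWithin] with σ hσ1 hσ0
  replace hσ0 : 0 ≤ σ := hσ0
  have htaylor : ∀ t, |ψ (t - σ) - ψ t + σ * deriv ψ t| ≤ ε * σ := by
    intro t
    have h1 := Convex.norm_image_sub_le_of_norm_hasDerivWithin_le (s := Icc (t - σ) t) (C := ε)
      (f := fun z => ψ z - z * deriv ψ t) (f' := fun z => deriv ψ z - deriv ψ t)
      (x := t) (y := t - σ) (fun z _ => by
        have h2 := ((hψ.differentiable one_ne_zero) z).hasDerivAt.sub
          ((hasDerivAt_id z).mul_const (deriv ψ t))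
        rw [one_mul] at h2
        exact h2.hasDerivWithinAt)
      (fun z hz => by
        rw [← dist_eq_norm]
        refine (hδε ?_).le
        rw [dist_eq_norm, norm_eq_abs, abs_lt]
        have := hσ1.trans_le (min_le_left _ _)
        constructor <;> linarith [hz.1, hz.2])
      (convex_Icc _ _) ⟨by linarith, le_rfl⟩ ⟨le_rfl, by linarith⟩
    have h3 : ‖t - σ - t‖ = σ := by
      rw [norm_eq_abs, show t - σ - t = -σ by ring, abs_neg, abs_of_nonneg hσ0]
    rw [h3, norm_eq_abs] at h1
    refine le_of_eq_of_le ?_ h1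
    congr 1; ring
  have hbound : ‖T σ h - T 0 h - (σ - 0) • w‖ ≤ (ε * σ) * ‖B‖ := by
    refine Lp.norm_le_mul_norm_of_ae_le_mul ?_
    have hsh : ∀ᵐ τ ∂(volume : Measure ℝ), h (τ - σ) = ψ (τ - σ) • u (τ - σ) :=
      (measurePreserving_sub_right volume σ).quasiMeasurePreserving.ae hh
    rw [hE.zero, sub_zero]
    filter_upwards [hsh, hh, hw, hE.semigroup_eq σ hσ0 h, hχu.coeFn_toLp,
      Lp.coeFn_sub (T σ h - (1 : Lp X p volume →L[ℝ] Lp X p volume) h) (σ • w),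
      Lp.coeFn_sub (T σ h) h, Lp.coeFn_smul σ w] with t h1 h2 h3 h4 h5 h6 h7 h8
    have h7' : (T σ h - (1 : Lp X p volume →L[ℝ] Lp X p volume) h : Lp X p volume) t
        = T σ h t - h t := h7
    rw [h6, Pi.sub_apply, h7', h8, Pi.smul_apply, h4, h1, h2, h3, h5, map_smul,
      hUu _ _ (by linarith)]
    have h9 : ψ (t - σ) • u t - ψ t • u t - σ • -(deriv ψ t • u t)
        = (ψ (t - σ) - ψ t + σ * deriv ψ t) • u t := by
      module
    rw [h9]
    rcases le_or_gt |t| (|R| + 1) with ht | ht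
    · have : χ t = 1 := χ.one_of_mem_closedBall (by simpa [χ] using ht)
      rw [this, one_smul, norm_smul]
      exact mul_le_mul_of_nonneg_right (htaylor t) (norm_nonneg _)
    · have hσ' := hσ1.trans_le (min_le_right _ _)
      have ha : R < |t - σ| := by
        have := abs_sub_abs_le_abs_sub t σ
        rw [abs_of_nonneg hσ0] at this
        linarith [le_abs_self R]
      have hb : R < |t| := by linarith [le_abs_self R]
      rw [hψ0 _ ha, hψ0 _ hb, hψ'0 _ hb]
      simp only [mul_zero, sub_zero, add_zero, zero_smul, norm_zero]
      positivity
  refine hbound.trans ?_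
  rw [sub_zero, norm_of_nonneg hσ0]
  have : ε * ‖B‖ ≤ c := by
    rw [hε, div_mul_eq_mul_div, div_le_iff₀ (by positivity)]
    nlinarith [norm_nonneg B]
  nlinarith

end IsEvolutionSemigroup

/-- The orbit of an invertible evolution family `U` through `x` at time `s`. -/
noncomputable def evolutionOrbit (U : ℝ → ℝ → X →L[ℝ] X) (s : ℝ) (x : X) : ℝ → X :=
  fun t => (if s ≤ t then U t s else Ring.inverse (U s t)) x

namespace IsEvolutionSemigroup

variable {p : ℝ≥0∞} [Fact (1 ≤ p)] {U : ℝ → ℝ → X →L[ℝ] X}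
  {T : ℝ → (Lp X p (volume : Measure ℝ) →L[ℝ] Lp X p (volume : Measure ℝ))}

theorem evolutionOrbit_self (hE : IsEvolutionSemigroup U T) (s : ℝ) (x : X) :
    evolutionOrbit U s x s = x := by
  simp [evolutionOrbit, hE.self]

theorem apply_evolutionOrbit_eq_self (hE : IsEvolutionSemigroup U T)
    (hinv : ∀ t s : ℝ, s ≤ t → Function.Bijective (U t s)) {s t : ℝ} (hts : t ≤ s) (x : X) :
    U s t (evolutionOrbit U s x t) = x := by
  rcases hts.eq_or_lt with rfl | hlt
  · simp [evolutionOrbit_self hE, hE.self]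
  · rw [evolutionOrbit, if_neg hlt.not_ge]
    have := Ring.mul_inverse_cancel _ (ContinuousLinearMap.isUnit_iff_bijective.2 (hinv s t hts))
    exact DFunLike.congr_fun this x

theorem apply_evolutionOrbit (hE : IsEvolutionSemigroup U T)
    (hinv : ∀ t s : ℝ, s ≤ t → Function.Bijective (U t s)) (s : ℝ) (x : X) {a t : ℝ}
    (hat : a ≤ t) : U t a (evolutionOrbit U s x a) = evolutionOrbit U s x t := by
  rcases le_total s a with hsa | has
  · rw [evolutionOrbit, evolutionOrbit, if_pos hsa, if_pos (hsa.trans hat), hE.comp_apply hsa hat]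
  rcases le_total s t with hst | hts
  · rw [← hE.comp_apply has hst, hE.apply_evolutionOrbit_eq_self hinv has, evolutionOrbit,
      if_pos hst]
  · apply (hinv s t hts).1
    rw [hE.comp_apply hat hts, hE.apply_evolutionOrbit_eq_self hinv has,
      hE.apply_evolutionOrbit_eq_self hinv hts]

theorem continuous_evolutionOrbit (hE : IsEvolutionSemigroup U T)
    (hinv : ∀ t s : ℝ, s ≤ t → Function.Bijective (U t s)) (s : ℝ) (x : X) :
    Continuous (evolutionOrbit U s x) := by
  refine continuous_iff_continuousAt.2 fun t₀ => ?_
  have h1 : Continuous fun t => U (max t (t₀ - 1)) (t₀ - 1) (evolutionOrbit U s x (t₀ - 1)) :=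
    hE.continuous_apply (continuous_id.max continuous_const) continuous_const continuous_const
      fun _ => le_max_right _ _
  refine h1.continuousAt.congr ?_
  filter_upwards [Ioi_mem_nhds (show t₀ - 1 < t₀ by linarith)] with t ht
  rw [max_eq_left (le_of_lt ht), hE.apply_evolutionOrbit hinv s x (le_of_lt ht)]

theorem eq_evolutionOrbit (hE : IsEvolutionSemigroup U T)
    (hinv : ∀ t s : ℝ, s ≤ t → Function.Bijective (U t s)) {s : ℝ} {x : X} {v : ℝ → X}
    (hvs : v s = x) (hv : ∀ a t, a ≤ t → U t a (v a) = v t) : v = evolutionOrbit U s x := by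
  funext t
  rcases le_total s t with hst | hts
  · rw [← hv s t hst, hvs, evolutionOrbit, if_pos hst]
  · apply (hinv s t hts).1
    rw [hv t s hts, hvs, hE.apply_evolutionOrbit_eq_self hinv hts]

end IsEvolutionSemigroup

/-- The part of a mild solution's approximating sequence lying in `[-d-2, d+2]`, cut off to an
element of `F_p`, inherits the integrated estimate. -/
theorem norm_apply_sub_le_of_local_solution {p : ℝ≥0∞} [Fact (1 ≤ p)] {U : ℝ → ℝ → X →L[ℝ] X}
    {T : ℝ → (Lp X p (volume : Measure ℝ) →L[ℝ] Lp X p (volume : Measure ℝ))}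
    (hE : IsEvolutionSemigroup U T) {Dom : ℝ → Set X} {Aop : ℝ → X → X}
    (hsmul : ∀ t, ∀ c : ℝ, ∀ y ∈ Dom t, c • y ∈ Dom t ∧ Aop t (c • y) = c • Aop t y)
    (hzero : ∀ t, (0 : X) ∈ Dom t ∧ Aop t 0 = 0)
    (hG : ∀ g g' af : ℝ → X, MemFpFunR Dom Aop p g g' af →
      ∀ f h : Lp X p (volume : Measure ℝ), (⇑f =ᵐ[(volume : Measure ℝ)] g) →
        (⇑h =ᵐ[(volume : Measure ℝ)] fun t => -(g' t) + af t) →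
        HasDerivWithinAt (fun σ => T σ f) h (Ici (0 : ℝ)) 0)
    {d : ℝ} (hd : 0 < d) {u u' an : ℝ → X}
    (hu : ∀ t₁ ∈ Icc (-(d + 2)) (d + 2), ∀ t₂ ∈ Icc (-(d + 2)) (d + 2),
      u t₂ - u t₁ = ∫ τ in t₁..t₂, u' τ)
    (hu' : MemLp u' p (volume.restrict (Icc (-(d + 2)) (d + 2))))
    (hdom : ∀ᵐ t ∂(volume.restrict (Icc (-(d + 2)) (d + 2))), u t ∈ Dom t ∧ an t = Aop t (u t))
    (han : MemLp an p (volume.restrict (Icc (-(d + 2)) (d + 2))))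
    {a t C : ℝ} (hda : -d ≤ a) (hat : a ≤ t) (htd : t ≤ d) (hC0 : 0 ≤ C)
    (hC : ∀ τ ∈ Icc a t, ‖U t τ‖ ≤ C) :
    ‖U t a (u a) - u t‖ ≤ C * ∫ τ in Icc (-(d + 2)) (d + 2), ‖-(u' τ) + an τ‖ := by
  set I : Set ℝ := Icc (-(d + 2)) (d + 2) with hI
  have hIm : MeasurableSet I := measurableSet_Icc
  have h0I : (0 : ℝ) ∈ I := ⟨by linarith, by linarith⟩
  set e' : ℝ → X := I.indicator u' with he'def
  have he'p : MemLp e' p volume := (memLp_indicator_iff_restrict hIm).2 hu'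
  have he'i : ∀ a b, IntervalIntegrable e' volume a b := fun a b =>
    ((he'p.locallyIntegrable Fact.out).integrableOn_isCompact isCompact_uIcc).intervalIntegrable
  set e : ℝ → X := fun t => u 0 + ∫ τ in (0 : ℝ)..t, e' τ with hedef
  have he : ∀ a b, e b - e a = ∫ τ in a..b, e' τ := fun a b => by
    simp only [hedef]
    rw [add_sub_add_left_eq_sub, intervalIntegral.integral_interval_sub_left (he'i _ _) (he'i _ _)]
  have hec : Continuous e := continuous_const.add (intervalIntegral.continuous_primitive he'i 0)
  have heu : ∀ t ∈ I, e t = u t := fun t ht => by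
    have h1 : ∫ τ in (0 : ℝ)..t, e' τ = ∫ τ in (0 : ℝ)..t, u' τ := by
      refine intervalIntegral.integral_congr fun τ hτ => ?_
      exact indicator_of_mem (ordConnected_Icc.uIcc_subset h0I ht hτ) _
    simp only [hedef]
    rw [h1, ← hu 0 h0I t ht]; abel
  set af : ℝ → X := I.indicator an with hafdef
  have hafp : MemLp af p volume := (memLp_indicator_iff_restrict hIm).2 han
  let φ : ContDiffBump (0 : ℝ) := ⟨d + 1 / 2, d + 1, by linarith, by linarith⟩
  have hφ1 : ContDiff ℝ 1 φ := φ.contDiff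
  have hφ0 : ∀ τ ∉ I, φ τ = 0 := fun τ hτ => by
    refine φ.zero_of_le_dist ?_
    rw [Real.dist_0_eq_abs]
    by_contra hlt
    have := abs_lt.1 (not_le.1 hlt)
    exact hτ ⟨by linarith [this.1, show φ.rOut = d + 1 from rfl],
      by linarith [this.2, show φ.rOut = d + 1 from rfl]⟩
  have hφ1' : ∀ τ ∈ Icc (-d) d, φ τ = 1 ∧ deriv φ τ = 0 := fun τ hτ => by
    have h1 : τ ∈ Metric.ball (0 : ℝ) φ.rIn := by
      rw [mem_ball_zero_iff, norm_eq_abs, abs_lt]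
      constructor <;> linarith [hτ.1, hτ.2, show φ.rIn = d + 1 / 2 from rfl]
    refine ⟨φ.one_of_mem_closedBall (Metric.ball_subset_closedBall h1), ?_⟩
    rw [(φ.eventuallyEq_one_of_mem_ball h1).deriv_eq]
    exact deriv_const τ (1 : ℝ)
  have hbdd : ∀ F : ℝ → X, MemLp F p volume → MemLp (fun τ => φ τ • F τ) p volume := fun F hF =>
    hF.of_le (φ.continuous.aestronglyMeasurable.smul hF.1) (Eventually.of_forall fun τ => by
      rw [norm_smul, norm_of_nonneg φ.nonneg]
      exact mul_le_of_le_one_left (norm_nonneg _) φ.le_one)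
  set g : ℝ → X := fun τ => φ τ • e τ with hgdef
  set g' : ℝ → X := fun τ => deriv φ τ • e τ + φ τ • e' τ with hg'def
  have hgc : Continuous g := φ.continuous.smul hec
  have hgs : HasCompactSupport g := φ.hasCompactSupport.smul_right
  have hg'p : MemLp g' p volume :=
    (((hφ1.continuous_deriv le_rfl).smul hec).memLp_of_hasCompactSupport
      φ.hasCompactSupport.deriv.smul_right).add (hbdd _ he'p)
  have hmem : MemFpFunR Dom Aop p g g' (fun τ => φ τ • af τ) := by
    refine ⟨hgc, hgs.is_zero_at_infty, fun s t => ?_, hg'p, ?_, hbdd _ hafp⟩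
    · exact smul_sub_smul_eq_integral_of_primitive hφ1 he'i he s t
    · filter_upwards [(ae_restrict_iff' hIm).1 hdom] with τ hτ
      by_cases hτI : τ ∈ I
      · obtain ⟨h1, h2⟩ := hτ hτI
        have h3 := hsmul τ (φ τ) (u τ) h1
        simp only [hgdef, hafdef, heu τ hτI, indicator_of_mem hτI, h2]
        exact ⟨h3.1, h3.2.symm⟩
      · simp only [hgdef, hφ0 τ hτI, zero_smul]
        exact ⟨(hzero τ).1, (hzero τ).2.symm⟩
  have hgp : MemLp g p volume := hgc.memLp_of_hasCompactSupport hgs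
  have hhp : MemLp (fun τ => -(g' τ) + φ τ • af τ) p volume := hg'p.neg.add (hbdd _ hafp)
  have hder := hG _ _ _ hmem hgp.toLp hhp.toLp hgp.coeFn_toLp hhp.coeFn_toLp
  have hmain := hE.norm_apply_sub_le hgc hgp.coeFn_toLp hder hat hC0 hC
  have hga : ∀ τ ∈ Icc (-d) d, g τ = u τ := fun τ hτ => by
    simp only [hgdef]
    rw [(hφ1' τ hτ).1, one_smul, heu τ ⟨by linarith [hτ.1], by linarith [hτ.2]⟩]
  rw [hga a ⟨hda, hat.trans htd⟩, hga t ⟨hda.trans hat, htd⟩] at hmain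
  refine hmain.trans (mul_le_mul_of_nonneg_left ?_ hC0)
  have hsub : Icc a t ⊆ I := Icc_subset_Icc (by linarith) (by linarith)
  have hcongr : ∫ τ in Icc a t, ‖hhp.toLp _ τ‖ = ∫ τ in Icc a t, ‖-(u' τ) + an τ‖ := by
    refine setIntegral_congr_ae measurableSet_Icc ?_
    filter_upwards [hhp.coeFn_toLp] with τ hτ hτm
    have h1 := hφ1' τ ⟨hda.trans hτm.1, hτm.2.trans htd⟩
    rw [hτ]
    simp only [hg'def, hafdef, he'def, h1.1, h1.2, indicator_of_mem (hsub hτm), zero_smul, one_smul,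
      zero_add]
  rw [hcongr]
  exact setIntegral_mono_set ((hu'.neg.add han).integrable Fact.out).norm
    (Eventually.of_forall fun _ => norm_nonneg _) hsub.eventuallyLE

theorem exists_cutoff {d : ℝ} (hd : 0 < d) : ∃ ψ : ℝ → ℝ, ContDiff ℝ 1 ψ ∧ HasCompactSupport ψ ∧
    (∀ t ∈ Icc (-d) d, ψ t = 1) ∧ ∀ t, ψ t ∈ Icc (0 : ℝ) 1 := by
  let χ : ContDiffBump (0 : ℝ) := ⟨d, d + 1, hd, by linarith⟩
  refine ⟨χ, χ.contDiff, χ.hasCompactSupport, fun t ht => χ.one_of_mem_closedBall ?_,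
    fun t => ⟨χ.nonneg, χ.le_one⟩⟩
  rw [mem_closedBall_zero_iff, norm_eq_abs]
  exact abs_le.2 ht

/-- **Mild solutions via evolution semigroups, invertible case on `ℝ`
(Theorem 3.13(ii)).**  Under the assumptions of the generation theorem on
`I = ℝ` (with `G` the closure of `G₀ = −d/dt + A(·)` generating the evolution
semigroup `T(·)` of an *invertible* evolution family `U(·,·)`), for every
`s ∈ ℝ` and `x ∈ X` the orbit `u = U(·,s)x` is the unique `(E_p)`-mild
solution on `ℝ`; moreover `u` is the only continuous function with
`u(s) = x`, `ψ_d u ∈ D(G)` and `G(ψ_d u) = 0` on `[−d,d]` for all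
`d > |s|`. -/
theorem mild_solution_unique_R
    (Dom : ℝ → Set X) (Aop : ℝ → X → X)
    (hdense : ∀ t : ℝ, Dense (Dom t))
    (M ω : ℝ) (hM : 1 ≤ M)
    (Res : ℝ → ℝ → X →L[ℝ] X)
    (hRes_mem : ∀ t : ℝ, ∀ lam : ℝ, ω < lam → ∀ x : X,
      Res lam t x ∈ Dom t ∧ lam • Res lam t x - Aop t (Res lam t x) = x)
    (hRes_inv : ∀ t : ℝ, ∀ lam : ℝ, ω < lam → ∀ y ∈ Dom t,
      Res lam t (lam • y - Aop t y) = y)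
    (hstable : ∀ (k : ℕ) (ts : Fin k → ℝ), Monotone ts →
      ∀ lam : ℝ, ω < lam →
        ‖((List.ofFn fun i => Res lam (ts i)).reverse).prod‖
          ≤ M * ((lam - ω) ^ k)⁻¹)
    (ω' : ℝ) (hω' : ω < ω')
    (hRes_cont : ∀ x : X, Continuous (fun t => Res ω' t x))
    (p : ℝ≥0∞) [Fact (1 ≤ p)] (hp : p ≠ ∞)
    -- the evolution family `U`, assumed invertible, and its evolution
    -- semigroup `T` on `E_p = L^p(ℝ,X)`
    (U : ℝ → ℝ → X →L[ℝ] X)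
    (T : ℝ → (Lp X p (volume : Measure ℝ) →L[ℝ] Lp X p (volume : Measure ℝ)))
    (hU_id : ∀ t : ℝ, U t t = 1)
    (hU_comp : ∀ t r s : ℝ, s ≤ r → r ≤ t → (U t r).comp (U r s) = U t s)
    (hU_cont : ∀ x : X, ContinuousOn (fun q : ℝ × ℝ => U q.1 q.2 x)
      {q : ℝ × ℝ | q.2 ≤ q.1})
    (hU_bound : ∃ M' ω'' : ℝ, 1 ≤ M' ∧ ∀ t s : ℝ, s ≤ t →
      ‖U t s‖ ≤ M' * exp (ω'' * (t - s)))
    (hU_inv : ∀ t s : ℝ, s ≤ t → Function.Bijective (U t s))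
    (hT_eq : ∀ σ : ℝ, 0 ≤ σ → ∀ f : Lp X p (volume : Measure ℝ),
      ⇑(T σ f) =ᵐ[(volume : Measure ℝ)] fun t => U t (t - σ) (f (t - σ)))
    (hT_zero : T 0 = 1)
    (hT_sg : ∀ σ τ : ℝ, 0 ≤ σ → 0 ≤ τ → T (σ + τ) = (T σ).comp (T τ))
    (hT_cont : ∀ f, ContinuousOn (fun σ => T σ f) (Ici (0:ℝ)))
    -- the generator `G` of `T`
    (DomG : Set (Lp X p (volume : Measure ℝ)))
    (Gmap : Lp X p (volume : Measure ℝ) → Lp X p (volume : Measure ℝ))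
    (hDomG : ∀ f, f ∈ DomG ↔
      ∃ h, HasDerivWithinAt (fun σ => T σ f) h (Ici (0:ℝ)) 0)
    (hGmap : ∀ f ∈ DomG,
      HasDerivWithinAt (fun σ => T σ f) (Gmap f) (Ici (0:ℝ)) 0)
    -- `G` is the closure of `G₀`
    (hG0 : ∀ g g' af : ℝ → X, MemFpFunR Dom Aop p g g' af →
      ∀ f h : Lp X p (volume : Measure ℝ),
        (⇑f =ᵐ[(volume : Measure ℝ)] g) →
        (⇑h =ᵐ[(volume : Measure ℝ)] fun t => -(g' t) + af t) →
        f ∈ DomG ∧ Gmap f = h)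
    (hcore : ∀ f ∈ DomG, ∀ ε : ℝ, 0 < ε →
      ∃ (f₀ h₀ : Lp X p (volume : Measure ℝ)) (g g' af : ℝ → X),
        MemFpFunR Dom Aop p g g' af ∧
        (⇑f₀ =ᵐ[(volume : Measure ℝ)] g) ∧
        (⇑h₀ =ᵐ[(volume : Measure ℝ)] fun t => -(g' t) + af t) ∧
        ‖f - f₀‖ + ‖Gmap f - h₀‖ < ε)
    (s : ℝ) (x : X) :
    -- `u = U(·,s)x` (extended by the inverses for `t < s`) is the unique
    -- `(E_p)`-mild solution on `ℝ`
    IsMildSolR s Dom Aop p x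
      (fun t => (if s ≤ t then U t s else Ring.inverse (U s t)) x) ∧
    (∀ v : ℝ → X, IsMildSolR s Dom Aop p x v →
      v = fun t => (if s ≤ t then U t s else Ring.inverse (U s t)) x) ∧
    -- `u` satisfies `ψ_d u ∈ D(G)` and `G(ψ_d u) = 0` on `[−d,d]` for every
    -- cut-off `ψ_d ∈ C¹_c(ℝ)` with `0 ≤ ψ_d ≤ 1`, `ψ_d = 1` on `[−d,d]` ...
    (∀ d : ℝ, |s| < d → ∀ ψ : ℝ → ℝ, ContDiff ℝ 1 ψ → HasCompactSupport ψ →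
      (∀ t ∈ Icc (-d) d, ψ t = 1) → (∀ t, ψ t ∈ Icc (0:ℝ) 1) →
      ∀ h : Lp X p (volume : Measure ℝ),
        (⇑h =ᵐ[(volume : Measure ℝ)] fun t =>
          ψ t • (if s ≤ t then U t s else Ring.inverse (U s t)) x) →
        h ∈ DomG ∧ ⇑(Gmap h) =ᵐ[volume.restrict (Icc (-d) d)] 0) ∧
    -- ... and is the only continuous function with these properties
    (∀ v : ℝ → X, Continuous v → v s = x →
      (∀ d : ℝ, |s| < d → ∀ ψ : ℝ → ℝ, ContDiff ℝ 1 ψ →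
        HasCompactSupport ψ → (∀ t ∈ Icc (-d) d, ψ t = 1) →
        (∀ t, ψ t ∈ Icc (0:ℝ) 1) →
        ∀ h : Lp X p (volume : Measure ℝ),
          (⇑h =ᵐ[(volume : Measure ℝ)] fun t => ψ t • v t) →
          h ∈ DomG ∧ ⇑(Gmap h) =ᵐ[volume.restrict (Icc (-d) d)] 0) →
      v = fun t => (if s ≤ t then U t s else Ring.inverse (U s t)) x) := by
  have hE : IsEvolutionSemigroup U T := ⟨hU_id, hU_comp, hU_cont, hU_bound, hT_eq, hT_zero⟩
  have hsmul : ∀ t, ∀ c : ℝ, ∀ y ∈ Dom t, c • y ∈ Dom t ∧ Aop t (c • y) = c • Aop t y := by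
    intro t c y hy
    have h1 := hRes_mem t ω' hω' (c • (ω' • y - Aop t y))
    rw [map_smul, hRes_inv t ω' hω' y hy] at h1
    refine ⟨h1.1, ?_⟩
    rw [← sub_sub_cancel (ω' • c • y) (Aop t (c • y)), h1.2]
    module
  have hzero : ∀ t, (0 : X) ∈ Dom t ∧ Aop t 0 = 0 := fun t => by
    simpa using hRes_mem t ω' hω' 0
  have hG : ∀ g g' af : ℝ → X, MemFpFunR Dom Aop p g g' af →
      ∀ f h : Lp X p (volume : Measure ℝ), (⇑f =ᵐ[(volume : Measure ℝ)] g) →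
        (⇑h =ᵐ[(volume : Measure ℝ)] fun t => -(g' t) + af t) →
        HasDerivWithinAt (fun σ => T σ f) h (Ici (0 : ℝ)) 0 := by
    intro g g' af hmem f h hf hh
    obtain ⟨h1, h2⟩ := hG0 g g' af hmem f h hf hh
    exact h2 ▸ hGmap f h1
  have hd0 : ∀ {d : ℝ}, |s| < d → 0 < d := fun h => (abs_nonneg s).trans_lt h
  have hu := hE.continuous_evolutionOrbit hU_inv s x
  have hUu : ∀ a t, a ≤ t → U t a (evolutionOrbit U s x a) = evolutionOrbit U s x t :=
    fun a t hat => hE.apply_evolutionOrbit hU_inv s x hat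
  have hcut : ∀ d : ℝ, |s| < d → ∀ ψ : ℝ → ℝ, ContDiff ℝ 1 ψ → HasCompactSupport ψ →
      (∀ t ∈ Icc (-d) d, ψ t = 1) → (∀ t, ψ t ∈ Icc (0:ℝ) 1) →
      ∀ h : Lp X p (volume : Measure ℝ),
        (⇑h =ᵐ[(volume : Measure ℝ)] fun t => ψ t • evolutionOrbit U s x t) →
        h ∈ DomG ∧ ⇑(Gmap h) =ᵐ[volume.restrict (Icc (-d) d)] 0 := by
    intro d hd ψ hψ hψc hψ1 hψ01 h hh
    have hwp : MemLp (fun t => -(deriv ψ t • evolutionOrbit U s x t)) p volume :=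
      (((hψ.continuous_deriv le_rfl).smul hu).memLp_of_hasCompactSupport
        hψc.deriv.smul_right).neg
    have hder := hE.hasDerivWithinAt_smul hu hUu hψ hψc hh hwp.coeFn_toLp
    have hmem : h ∈ DomG := (hDomG h).2 ⟨_, hder⟩
    refine ⟨hmem, ?_⟩
    rw [(uniqueDiffOn_Ici (0 : ℝ) 0 self_mem_Ici).eq_deriv _ (hGmap h hmem) hder]
    refine (ae_restrict_iff' measurableSet_Icc).2 ?_
    filter_upwards [hwp.coeFn_toLp] with t ht htm
    have hmax : IsLocalMax ψ t := Eventually.of_forall fun y => by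
      rw [hψ1 t htm]; exact (hψ01 y).2
    rw [ht, hmax.deriv_eq_zero]
    simp
  refine ⟨?_, ?_, hcut, ?_⟩
  · refine ⟨hu, hE.evolutionOrbit_self s x, fun d hd => ?_⟩
    obtain ⟨ψ, hψ, hψc, hψ1, hψ01⟩ := exists_cutoff (hd0 hd)
    have hψu : Continuous fun t => ψ t • evolutionOrbit U s x t := hψ.continuous.smul hu
    have hfp : MemLp (fun t => ψ t • evolutionOrbit U s x t) p volume :=
      hψu.memLp_of_hasCompactSupport hψc.smul_right
    obtain ⟨hmem, hG'⟩ := hcut d hd ψ hψ hψc hψ1 hψ01 hfp.toLp hfp.coeFn_toLp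
    have happ := fun n : ℕ => hcore hfp.toLp hmem (1 / ((n : ℝ) + 1)) Nat.one_div_pos_of_nat
    choose f₀ h₀ un un' an hmemF hf₀ hh₀ hlt using happ
    obtain ⟨K, hK0, hK⟩ := hE.exists_norm_le_graph d
    have hlim : Tendsto (fun n : ℕ => 1 / ((n : ℝ) + 1)) atTop (𝓝 0) :=
      tendsto_one_div_add_atTop_nhds_zero_nat
    have hunif : ∀ n, ∀ t ∈ Icc (-d) d,
        ‖un n t - evolutionOrbit U s x t‖ ≤ K * (1 / ((n : ℝ) + 1)) := by
      intro n t ht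
      have hder := (hG _ _ _ (hmemF n) _ _ (hf₀ n) (hh₀ n)).sub (hGmap _ hmem)
      have hder' : HasDerivWithinAt (fun σ => T σ (f₀ n - hfp.toLp)) (h₀ n - Gmap hfp.toLp)
          (Ici (0 : ℝ)) 0 := by
        refine hder.congr_of_mem (fun σ _ => ?_) self_mem_Ici
        simp
      have hrep : ⇑(f₀ n - hfp.toLp) =ᵐ[volume]
          fun t => un n t - ψ t • evolutionOrbit U s x t := by
        filter_upwards [Lp.coeFn_sub (f₀ n) hfp.toLp, hf₀ n, hfp.coeFn_toLp] with τ h1 h2 h3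
        rw [h1, Pi.sub_apply, h2, h3]
      have h4 := hK _ _ _ ((hmemF n).1.sub hψu) hrep hder' t ht
      rw [Pi.sub_apply, hψ1 t ht, one_smul] at h4
      refine h4.trans (mul_le_mul_of_nonneg_left ?_ hK0)
      rw [norm_sub_rev, norm_sub_rev (h₀ n)]
      exact (hlt n).le
    refine ⟨un, un', an, fun n => ?_, ?_, ?_⟩
    · obtain ⟨-, -, h1, h2, h3, h4⟩ := hmemF n
      exact ⟨fun t₁ _ t₂ _ => h1 t₁ t₂, h2.restrict _, ae_restrict_of_ae h3, h4.restrict _⟩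
    · intro ε hε
      have h1 : Tendsto (fun n : ℕ => K * (1 / ((n : ℝ) + 1))) atTop (𝓝 0) := by
        simpa using hlim.const_mul K
      obtain ⟨N, hN⟩ := eventually_atTop.1 (h1.eventually_le_const hε)
      exact ⟨N, fun n hn t ht => (hunif n t ht).trans (hN n hn)⟩
    · have h1 : Tendsto (fun n : ℕ => ENNReal.ofReal (1 / ((n : ℝ) + 1))) atTop (𝓝 0) := by
        simpa using ENNReal.tendsto_ofReal hlim
      refine tendsto_of_tendsto_of_tendsto_of_le_of_le tendsto_const_nhds h1
        (fun _ => zero_le) fun n => ?_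
      have h2 : (fun t => -(un' n t) + an n t) =ᵐ[volume.restrict (Icc (-d) d)]
          ⇑(h₀ n - Gmap hfp.toLp) := by
        filter_upwards [ae_restrict_of_ae (hh₀ n), hG',
          ae_restrict_of_ae (Lp.coeFn_sub (h₀ n) (Gmap hfp.toLp))] with τ h3 h4 h5
        rw [h5, Pi.sub_apply, h3, h4, Pi.zero_apply, sub_zero]
      calc eLpNorm (fun t => -(un' n t) + an n t) p (volume.restrict (Icc (-d) d))
          = eLpNorm (h₀ n - Gmap hfp.toLp) p (volume.restrict (Icc (-d) d)) :=
            eLpNorm_congr_ae h2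
        _ ≤ eLpNorm (h₀ n - Gmap hfp.toLp) p volume :=
            eLpNorm_mono_measure _ Measure.restrict_le_self
        _ = ENNReal.ofReal ‖h₀ n - Gmap hfp.toLp‖ := by
            rw [Lp.norm_def, ENNReal.ofReal_toReal (Lp.memLp _).2.ne]
        _ ≤ ENNReal.ofReal (1 / ((n : ℝ) + 1)) := by
            refine ENNReal.ofReal_le_ofReal ?_
            rw [norm_sub_rev]
            linarith [hlt n, norm_nonneg (hfp.toLp - f₀ n)]
  · rintro v ⟨-, hvs, hv⟩
    refine hE.eq_evolutionOrbit hU_inv hvs fun a t hat => ?_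
    set d : ℝ := |s| + |a| + |t| + 1 with hd
    have hsd : |s| < d := by linarith [abs_nonneg a, abs_nonneg t]
    have hda : -d ≤ a := by
      linarith [neg_abs_le a, abs_nonneg s, abs_nonneg t]
    have htd : t ≤ d := by
      linarith [le_abs_self t, abs_nonneg s, abs_nonneg a]
    obtain ⟨un, un', an, hn, hlim, herr⟩ := hv (d + 2) (by linarith)
    obtain ⟨C, hC0, hC⟩ := hE.exists_norm_le (t - a)
    obtain ⟨K, hK0, hK⟩ := exists_integral_norm_le_eLpNorm (X := X) p Fact.out (-(d + 2)) (d + 2)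
    have hptw : ∀ τ ∈ Icc (-(d + 2)) (d + 2), Tendsto (fun n => un n τ) atTop (𝓝 (v τ)) := by
      intro τ hτ
      refine Metric.tendsto_atTop.2 fun ε hε => ?_
      obtain ⟨N, hN⟩ := hlim (ε / 2) (by positivity)
      exact ⟨N, fun n hn => by rw [dist_eq_norm]; linarith [hN n hn τ hτ]⟩
    have hta := hptw a ⟨by linarith, by linarith⟩
    have htt := hptw t ⟨by linarith, by linarith⟩
    have hle : ∀ n, ‖U t a (un n a) - un n t‖ ≤ C * (K * (eLpNorm (fun t => -(un' n t) + an n t) p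
        (volume.restrict (Icc (-(d + 2)) (d + 2)))).toReal) := by
      intro n
      obtain ⟨h1, h2, h3, h4⟩ := hn n
      exact (norm_apply_sub_le_of_local_solution hE hsmul hzero hG (hd0 hsd) h1 h2 h3 h4 hda hat
        htd hC0 fun τ hτ => hC t τ hτ.2 (by linarith [hτ.1])).trans
        (mul_le_mul_of_nonneg_left (hK _ (h2.neg.add h4)) hC0)
    have hR : Tendsto (fun n => C * (K * (eLpNorm (fun t => -(un' n t) + an n t) p
        (volume.restrict (Icc (-(d + 2)) (d + 2)))).toReal)) atTop (𝓝 0) := by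
      have := (ENNReal.tendsto_toReal ENNReal.zero_ne_top).comp herr
      simpa using (this.const_mul K).const_mul C
    have hL : Tendsto (fun n => ‖U t a (un n a) - un n t‖) atTop (𝓝 ‖U t a (v a) - v t‖) :=
      ((((U t a).continuous.tendsto _).comp hta).sub htt).norm
    have := le_of_tendsto_of_tendsto' hL hR hle
    exact sub_eq_zero.1 (norm_le_zero_iff.1 this)
  · intro v hvc hvs hv
    refine hE.eq_evolutionOrbit hU_inv hvs fun a t hat => ?_
    set d : ℝ := |s| + |a| + |t| + 1 with hd
    have hsd : |s| < d := by linarith [abs_nonneg a, abs_nonneg t]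
    have hda : -d ≤ a := by
      linarith [neg_abs_le a, abs_nonneg s, abs_nonneg t]
    have htd : t ≤ d := by
      linarith [le_abs_self t, abs_nonneg s, abs_nonneg a]
    obtain ⟨ψ, hψ, hψc, hψ1, hψ01⟩ := exists_cutoff (hd0 hsd)
    have hψv : Continuous fun t => ψ t • v t := hψ.continuous.smul hvc
    have hfp : MemLp (fun t => ψ t • v t) p volume :=
      hψv.memLp_of_hasCompactSupport hψc.smul_right
    obtain ⟨hmem, hG'⟩ := hv d hsd ψ hψ hψc hψ1 hψ01 hfp.toLp hfp.coeFn_toLp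
    obtain ⟨C, hC0, hC⟩ := hE.exists_norm_le (t - a)
    have hmain := hE.norm_apply_sub_le hψv hfp.coeFn_toLp (hGmap _ hmem) hat hC0
      fun τ hτ => hC t τ hτ.2 (by linarith [hτ.1])
    have hint : ∫ τ in Icc a t, ‖Gmap hfp.toLp τ‖ = 0 := by
      refine integral_eq_zero_of_ae ?_
      filter_upwards [ae_restrict_of_ae_restrict_of_subset (Icc_subset_Icc hda htd) hG'] with τ hτ
      rw [hτ]; simp
    rw [hint, mul_zero, hψ1 a ⟨hda, hat.trans htd⟩, hψ1 t ⟨hda.trans hat, htd⟩, one_smul,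
      one_smul] at hmain
    exact sub_eq_zero.1 (norm_le_zero_iff.1 hmain)
end

section
/- Let X be a reflexive Banach space, I = [a,b] a compact interval, 1 < p < ∞ and 1/p + 1/q = 1, and for every t ∈ I let A(t) : D(A(t)) → X be the generator of a strongly continuous semigroup of contractions. Then for every initial value x ∈ X there exists a weak solution u ∈ L^p(I,X) of the nonautonomous Cauchy problem u'(t) = A(t)u(t), u(a) = x; that is, ∫_I [(ḟ(t), u(t)) + (A(t)*f(t), u(t))] dt + (f(a), x) = 0 for all f in the test space 𝒯. -/
open MeasureTheory Set Real Filter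
open scoped ENNReal Topology

/-- Continuous functionals on `L¹` of a finite measure have an integrable density. -/
lemma exists_integrable_density {α : Type*} [MeasurableSpace α] (μ : Measure α) [IsFiniteMeasure μ]
    (ψ : StrongDual ℝ (Lp ℝ 1 μ)) :
    ∃ k : α → ℝ, Integrable k μ ∧ ∀ s (hs : MeasurableSet s),
      ψ (indicatorConstLp 1 hs (measure_ne_top μ s) 1) = ∫ t in s, k t ∂μ := by
  let J : Lp ℝ 2 μ →L[ℝ] Lp ℝ 1 μ :=
    (ContinuousLinearMap.mul ℝ ℝ).holderL μ 2 2 1 (Lp.const 2 μ 1)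
  let k := (InnerProductSpace.toDual ℝ (Lp ℝ 2 μ)).symm (ψ.comp J)
  refine ⟨k, (Lp.memLp k).integrable one_le_two, fun s hs ↦ ?_⟩
  have hJ : J (indicatorConstLp 2 hs (measure_ne_top μ s) 1) =
      indicatorConstLp 1 hs (measure_ne_top μ s) 1 := by
    apply Lp.ext
    refine (ContinuousLinearMap.coeFn_holder _ _ _).trans ?_
    filter_upwards [indicatorConstLp_coeFn (p := 1) (hs := hs) (hμs := measure_ne_top μ s)
      (c := (1 : ℝ)), indicatorConstLp_coeFn (p := 2) (hs := hs) (hμs := measure_ne_top μ s)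
      (c := (1 : ℝ)), Lp.coeFn_const 2 μ (1 : ℝ)] with t h1 h2 h3
    rw [h1, h2, h3]
    simp
  have h := InnerProductSpace.toDual_symm_apply (𝕜 := ℝ)
    (x := indicatorConstLp 2 hs (measure_ne_top μ s) (1 : ℝ)) (y := ψ.comp J)
  rw [ContinuousLinearMap.comp_apply, hJ, real_inner_comm,
    L2.inner_indicatorConstLp_one hs (measure_ne_top μ s)] at h
  exact h.symm

/-- **Pettis measurability theorem** for functions with values in a separable Banach space. -/
lemma aestronglyMeasurable_of_forall_dual {α : Type*} [MeasurableSpace α] {μ : Measure α}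
    {Y : Type*} [NormedAddCommGroup Y] [NormedSpace ℝ Y] [CompleteSpace Y]
    [SecondCountableTopology Y] {u : α → Y}
    (hu : ∀ φ : StrongDual ℝ Y, AEMeasurable (fun t ↦ φ (u t)) μ) :
    AEStronglyMeasurable u μ := by
  borelize Y
  choose φ hφ hφs using fun k ↦ exists_dual_vector'' ℝ (TopologicalSpace.denseSeq Y k)
  have hemb : MeasurableEmbedding fun (z : Y) (k : ℕ) ↦ φ k z := by
    refine Continuous.measurableEmbedding (continuous_pi fun k ↦ (φ k).continuous) ?_
    intro z w hzw
    by_contra hne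
    have hpos : 0 < ‖z - w‖ := norm_pos_iff.2 (sub_ne_zero.2 hne)
    obtain ⟨k, hk⟩ := (TopologicalSpace.denseRange_denseSeq Y).exists_dist_lt (z - w)
      (half_pos hpos)
    set s := TopologicalSpace.denseSeq Y k
    have h0 : φ k (z - w) = 0 := by
      rw [map_sub, sub_eq_zero]
      exact congrFun hzw k
    have h1 : ‖s‖ ≤ ‖s - (z - w)‖ := by
      calc ‖s‖ = φ k (s - (z - w)) := by rw [map_sub, h0, sub_zero, hφs]; rfl
        _ ≤ ‖φ k (s - (z - w))‖ := le_abs_self _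
        _ ≤ 1 * ‖s - (z - w)‖ := (φ k).le_of_opNorm_le (hφ k) _
        _ = _ := one_mul _
    rw [dist_comm, dist_eq_norm] at hk
    have h2 : ‖z - w‖ ≤ ‖s‖ + ‖s - (z - w)‖ := by
      simpa using norm_sub_le s (s - (z - w))
    linarith
  exact (hemb.aemeasurable_comp_iff.1
    (aemeasurable_pi_lambda _ fun k ↦ hu (φ k))).aestronglyMeasurable

/-- Bounded families in a reflexive space converge weakly along every ultrafilter. -/
lemma exists_weak_limit_ultrafilter {X : Type*} [NormedAddCommGroup X] [NormedSpace ℝ X]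
    (hrefl : Function.Surjective (NormedSpace.inclusionInDoubleDual ℝ X))
    {ι : Type*} (l : Ultrafilter ι) {d : ι → X} {C : ℝ} (hd : ∀ i, ‖d i‖ ≤ C) :
    ∃ y : X, ∀ φ : StrongDual ℝ X, Tendsto (fun i ↦ φ (d i)) l (𝓝 (φ y)) := by
  have hb : ∀ (φ : StrongDual ℝ X) i, |φ (d i)| ≤ C * ‖φ‖ := fun φ i ↦ by
    have := φ.le_opNorm (d i)
    rw [Real.norm_eq_abs] at this
    nlinarith [mul_le_mul_of_nonneg_left (hd i) (norm_nonneg φ)]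
  have hL : ∀ φ : StrongDual ℝ X, ∃ c ∈ Icc (-(C * ‖φ‖)) (C * ‖φ‖),
      Tendsto (fun i ↦ φ (d i)) l (𝓝 c) := fun φ ↦
    isCompact_Icc.ultrafilter_le_nhds (l.map fun i ↦ φ (d i))
      (le_principal_iff.2 (mem_map.2 (univ_mem' fun i ↦ abs_le.1 (hb φ i))))
  choose L hLC hL using hL
  let Φ : StrongDual ℝ (StrongDual ℝ X) := LinearMap.mkContinuous
    { toFun := L
      map_add' := fun φ ψ ↦ tendsto_nhds_unique (hL (φ + ψ)) ((hL φ).add (hL ψ))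
      map_smul' := fun c φ ↦ tendsto_nhds_unique (hL (c • φ)) ((hL φ).const_smul c) } C
    fun φ ↦ abs_le.2 (hLC φ)
  obtain ⟨y, hy⟩ := hrefl Φ
  refine ⟨y, fun φ ↦ ?_⟩
  have : φ y = L φ := by
    rw [← NormedSpace.dual_def ℝ, hy]; rfl
  rw [this]
  exact hL φ

/-- Weak limits of families in a closed subspace belong to that subspace. -/
lemma mem_of_weak_tendsto {X : Type*} [NormedAddCommGroup X] [NormedSpace ℝ X]
    {S : Submodule ℝ X} (hS : IsClosed (S : Set X)) {ι : Type*} {l : Filter ι} [l.NeBot]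
    {d : ι → X} (hd : ∀ i, d i ∈ S) {y : X}
    (hy : ∀ φ : StrongDual ℝ X, Tendsto (fun i ↦ φ (d i)) l (𝓝 (φ y))) : y ∈ S := by
  by_contra hyS
  obtain ⟨φ, c, hφy, hφS⟩ := geometric_hahn_banach_point_closed S.convex hS hyS
  exact absurd (ge_of_tendsto' (hy φ) fun i ↦ (hφS _ (hd i)).le) (not_le.2 hφy)

/-- The norm is weakly lower semicontinuous: norm bounds pass to weak limits. -/
lemma norm_le_of_weak_tendsto {X : Type*} [NormedAddCommGroup X] [NormedSpace ℝ X]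
    {ι : Type*} {l : Filter ι} [l.NeBot] {d : ι → X} {C : ℝ} (hd : ∀ i, ‖d i‖ ≤ C) {y : X}
    (hy : ∀ φ : StrongDual ℝ X, Tendsto (fun i ↦ φ (d i)) l (𝓝 (φ y))) : ‖y‖ ≤ C := by
  obtain ⟨φ, hφ, hφy⟩ := exists_dual_vector'' ℝ y
  have := le_of_tendsto' (hy φ) fun i ↦
    (le_abs_self _).trans (((φ.le_of_opNorm_le hφ _).trans_eq (one_mul _)).trans (hd i))
  rw [hφy] at this
  exact this

/-- Resolvent bounds make `1 - h A*` expanding. -/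
lemma norm_le_norm_sub_smul_of_resolvent {X : Type*} [NormedAddCommGroup X] [NormedSpace ℝ X]
    {A : X →ₗ.[ℝ] X} {h : ℝ} (hh : 0 < h) {R : X →L[ℝ] X}
    (hR : ∀ x : X, ∃ hx : R x ∈ A.domain, h⁻¹ • R x - A ⟨R x, hx⟩ = x) (hRb : ‖R‖ ≤ h)
    {φ ψ : StrongDual ℝ X} (hψ : ∀ y : A.domain, ψ (y : X) = φ (A y)) :
    ‖φ‖ ≤ ‖φ - h • ψ‖ := by
  refine ContinuousLinearMap.opNorm_le_bound _ (norm_nonneg _) fun x ↦ ?_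
  obtain ⟨hx, hxe⟩ := hR x
  have h1 : φ x = h⁻¹ * (φ - h • ψ) (R x) := by
    conv_lhs => rw [← hxe]
    have := hψ ⟨R x, hx⟩
    simp only [map_sub, map_smul, ← this, smul_eq_mul, sub_apply,
      smul_apply]
    field_simp
  rw [h1, norm_mul, Real.norm_of_nonneg (inv_pos.2 hh).le]
  calc h⁻¹ * ‖(φ - h • ψ) (R x)‖ ≤ h⁻¹ * (‖φ - h • ψ‖ * (h * ‖x‖)) := by
        gcongr
        exact ((φ - h • ψ).le_opNorm _).trans (by gcongr; exact R.le_of_opNorm_le hRb x)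
    _ = ‖φ - h • ψ‖ * ‖x‖ := by field_simp

/-- The a priori estimate for the backward adjoint problem with dissipative operators. -/
lemma norm_le_integral_of_dissipative {E : Type*} [NormedAddCommGroup E] [NormedSpace ℝ E]
    {a b : ℝ} (hab : a ≤ b) {f f' fA : ℝ → E}
    (hf : ∀ t ∈ Icc a b, HasDerivAt f (f' t) t) (hf' : ContinuousOn f' (Icc a b))
    (hfA : ContinuousOn fA (Icc a b))
    (hdiss : ∀ t ∈ Icc a b, ∀ h : ℝ, 0 < h → ‖f t‖ ≤ ‖f t - h • fA t‖) (hfb : f b = 0) :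
    ‖f a‖ ≤ ∫ t in a..b, ‖f' t + fA t‖ := by
  have hg : ContinuousOn (fun t ↦ ‖f' t + fA t‖) (Icc a b) := (hf'.add hfA).norm
  have hfc : ContinuousOn f (Icc a b) := fun t ht ↦ (hf t ht).continuousAt.continuousWithinAt
  have hint : IntervalIntegrable (fun t ↦ ‖f' t + fA t‖) volume a b :=
    ContinuousOn.intervalIntegrable (by rwa [uIcc_of_le hab])
  have key := image_le_of_liminf_slope_right_le_deriv_boundary (f := fun t ↦ -‖f t‖)
    (B := fun t ↦ (∫ s in a..t, ‖f' s + fA s‖) - ‖f a‖) (B' := fun t ↦ ‖f' t + fA t‖)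
    hfc.norm.neg (by simp) ?_ ?_ ?_ (right_mem_Icc.2 hab)
  · simpa [hfb] using key
  · refine ContinuousOn.sub ?_ continuousOn_const
    have := intervalIntegral.continuousOn_primitive_interval'
      hint left_mem_uIcc
    rwa [uIcc_of_le hab] at this
  · intro t ht
    refine HasDerivWithinAt.sub_const _ ?_
    have hti : IntervalIntegrable (fun t ↦ ‖f' t + fA t‖) volume a t :=
      hint.mono_set (by
        rw [uIcc_of_le hab, uIcc_of_le ht.1]
        exact Icc_subset_Icc_right ht.2.le)
    have hmem : Icc a b ∈ 𝓝[>] t := mem_of_superset (Ioc_mem_nhdsGT ht.2)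
      (Ioc_subset_Icc_self.trans (Icc_subset_Icc_left ht.1))
    have hcw : ContinuousWithinAt (fun t ↦ ‖f' t + fA t‖) (Ioi t) t :=
      (hg t ⟨ht.1, ht.2.le⟩).mono_of_mem_nhdsWithin hmem
    refine intervalIntegral.integral_hasDerivWithinAt_right hti ?_ hcw
    exact ⟨Icc a b, hmem, hg.aestronglyMeasurable measurableSet_Icc⟩
  · intro t ht r hr
    have htI : t ∈ Icc a b := ⟨ht.1, ht.2.le⟩
    have hslope : Tendsto (slope f t) (𝓝[>] t) (𝓝 (f' t)) :=
      (hasDerivAt_iff_tendsto_slope.1 (hf t htI)).mono_left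
        (nhdsWithin_mono _ fun s hs ↦ ne_of_gt hs)
    have hlim : Tendsto (fun z ↦ ‖slope f t z + fA t‖) (𝓝[>] t) (𝓝 ‖f' t + fA t‖) :=
      (hslope.add_const _).norm
    refine Eventually.frequently ?_
    filter_upwards [hlim.eventually (gt_mem_nhds hr), self_mem_nhdsWithin] with z hz hzt
    refine lt_of_le_of_lt ?_ hz
    have hpos : 0 < z - t := sub_pos.2 hzt
    have hd := hdiss t htI (z - t) hpos
    have hfz : f t - (z - t) • fA t = f z - (z - t) • (slope f t z + fA t) := by
      rw [smul_add, sub_smul_slope]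
      simp only [vsub_eq_sub]
      abel
    rw [hfz] at hd
    have h3 := hd.trans (norm_sub_le _ _)
    rw [norm_smul, Real.norm_of_nonneg hpos.le] at h3
    rw [slope_def_field, div_le_iff₀ hpos]
    linarith

/-- Bounded operators from `L¹` of a compact interval to a reflexive space are represented by a
bounded strongly measurable density. -/
lemma exists_density_of_reflexive {X : Type*} [NormedAddCommGroup X] [NormedSpace ℝ X]
    [CompleteSpace X] (hrefl : Function.Surjective (NormedSpace.inclusionInDoubleDual ℝ X))
    {a b : ℝ} {μ : Measure ℝ} [IsFiniteMeasure μ] (hμ : μ = volume.restrict (Icc a b))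
    (T : Lp ℝ 1 μ →L[ℝ] X) :
    ∃ u : ℝ → X, AEStronglyMeasurable u μ ∧ (∀ t, ‖u t‖ ≤ ‖T‖) ∧
      ∀ (φ : StrongDual ℝ X) (s : Set ℝ) (hs : MeasurableSet s),
        φ (T (indicatorConstLp 1 hs (measure_ne_top μ s) 1)) = ∫ t in s, φ (u t) ∂μ := by
  let δ : ℕ → ℝ := fun n ↦ 1 / ((n : ℝ) + 1)
  have hδ : ∀ n, 0 < δ n := fun n ↦ by positivity
  have hδlim : Tendsto δ atTop (𝓝[>] 0) := tendsto_nhdsWithin_iff.2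
    ⟨tendsto_one_div_add_atTop_nhds_zero_nat, Eventually.of_forall hδ⟩
  let d : ℝ → ℕ → X := fun t n ↦ (2 * δ n)⁻¹ • T (indicatorConstLp 1
    (Metric.isClosed_closedBall (x := t) (ε := δ n)).measurableSet (measure_ne_top μ _) 1)
  have hd : ∀ t n, ‖d t n‖ ≤ ‖T‖ := fun t n ↦ by
    have h1 : μ.real (Metric.closedBall t (δ n)) ≤ 2 * δ n := by
      rw [← Real.volume_real_closedBall (hδ n).le (a := t)]
      rw [hμ]
      exact ENNReal.toReal_mono measure_closedBall_lt_top.ne (Measure.restrict_apply_le _ _)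
    rw [norm_smul, norm_inv, Real.norm_of_nonneg (by linarith [hδ n]),
      inv_mul_le_iff₀ (by linarith [hδ n])]
    refine (T.le_opNorm _).trans ?_
    rw [norm_indicatorConstLp one_ne_zero ENNReal.one_ne_top]
    simp only [norm_one, ENNReal.toReal_one, div_one, Real.rpow_one, one_mul]
    rw [mul_comm]
    gcongr
  choose u hu using fun t ↦
    exists_weak_limit_ultrafilter hrefl (Ultrafilter.of (atTop : Filter ℕ)) (hd t)
  have huk : ∀ (φ : StrongDual ℝ X) (k : ℝ → ℝ), Integrable k μ → (∀ s (hs : MeasurableSet s),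
      φ.comp T (indicatorConstLp 1 hs (measure_ne_top μ s) 1) = ∫ t in s, k t ∂μ) →
      (fun t ↦ φ (u t)) =ᵐ[μ] k := by
    intro φ k hk hφ
    have hK : Integrable ((Icc a b).indicator k) volume :=
      (integrable_indicator_iff measurableSet_Icc).2 (hμ ▸ hk : Integrable k _)
    have hae : ∀ᵐ t ∂μ, t ∈ Icc a b := hμ ▸ ae_restrict_mem measurableSet_Icc
    have hac : μ ≪ volume := hμ ▸ Measure.absolutelyContinuous_of_le Measure.restrict_le_self
    filter_upwards [hac.ae_le (IsUnifLocDoublingMeasure.ae_tendsto_average volume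
      hK.locallyIntegrable 1), hae] with t ht htI
    have h1 := ht (fun _ : ℕ ↦ t) δ hδlim
      (Eventually.of_forall fun n ↦ Metric.mem_closedBall_self (by linarith [hδ n]))
    rw [indicator_of_mem htI] at h1
    refine tendsto_nhds_unique (hu t φ) ((h1.mono_left (Ultrafilter.of_le _)).congr fun n ↦ ?_)
    have hm : MeasurableSet (Metric.closedBall t (δ n)) := Metric.isClosed_closedBall.measurableSet
    have h2 := hφ _ hm
    rw [ContinuousLinearMap.comp_apply] at h2
    simp only [d, map_smul, smul_eq_mul]
    rw [h2, setAverage_eq, Real.volume_real_closedBall (hδ n).le, smul_eq_mul,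
      setIntegral_indicator measurableSet_Icc, hμ, Measure.restrict_restrict hm]
  have huφ : ∀ φ : StrongDual ℝ X, AEMeasurable (fun t ↦ φ (u t)) μ := fun φ ↦ by
    obtain ⟨k, hk, hφ⟩ := exists_integrable_density μ (φ.comp T)
    exact hk.aemeasurable.congr (huk φ k hk hφ).symm
  refine ⟨u, ?_, fun t ↦ norm_le_of_weak_tendsto (hd t) (hu t), fun φ s hs ↦ ?_⟩
  · let S := (LinearMap.range (T : Lp ℝ 1 μ →ₗ[ℝ] X)).topologicalClosure
    have hScl : IsClosed (S : Set X) := Submodule.isClosed_topologicalClosure _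
    have hSsep : TopologicalSpace.IsSeparable (S : Set X) := by
      have : Fact ((1 : ℝ≥0∞) ≠ ∞) := ⟨ENNReal.one_ne_top⟩
      have := TopologicalSpace.isSeparable_range T.continuous
      exact this.closure
    have : CompleteSpace S := hScl.completeSpace_coe
    have : TopologicalSpace.SeparableSpace S := hSsep.separableSpace
    have : SecondCountableTopology S := UniformSpace.secondCountable_of_separable S
    have hmem : ∀ t, u t ∈ S := fun t ↦ mem_of_weak_tendsto hScl
      (fun n ↦ S.smul_mem _ (Submodule.le_topologicalClosure _ ⟨_, rfl⟩)) (hu t)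
    refine S.subtypeL.continuous.comp_aestronglyMeasurable
      (g := fun z : S ↦ (z : X)) (f := fun t ↦ (⟨u t, hmem t⟩ : S))
      (aestronglyMeasurable_of_forall_dual fun φ ↦ ?_)
    obtain ⟨φ', hφ', -⟩ := exists_extension_norm_eq S φ
    simpa only [← hφ'] using huφ φ'
  · obtain ⟨k, hk, hφ⟩ := exists_integrable_density μ (φ.comp T)
    rw [← ContinuousLinearMap.comp_apply, hφ s hs]
    exact integral_congr_ae (ae_restrict_of_ae (huk φ k hk hφ).symm)

/-- A functional on `L¹(μ, X*)` with `X` reflexive induces an operator from `L¹(μ)` to `X`. -/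
lemma exists_operator_of_dual_L1 {α : Type*} [MeasurableSpace α] {μ : Measure α}
    [IsFiniteMeasure μ] {X : Type*} [NormedAddCommGroup X] [NormedSpace ℝ X]
    (hrefl : Function.Surjective (NormedSpace.inclusionInDoubleDual ℝ X))
    (Λ : StrongDual ℝ (Lp (StrongDual ℝ X) 1 μ)) :
    ∃ T : Lp ℝ 1 μ →L[ℝ] X, ∀ (φ : StrongDual ℝ X) (s : Set α) (hs : MeasurableSet s),
      φ (T (indicatorConstLp 1 hs (measure_ne_top μ s) 1)) =
        Λ (indicatorConstLp 1 hs (measure_ne_top μ s) φ) := by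
  let ι := LinearIsometryEquiv.ofSurjective (NormedSpace.inclusionInDoubleDualLi ℝ (E := X)) hrefl
  let B := (ContinuousLinearMap.lsmul ℝ ℝ : ℝ →L[ℝ] StrongDual ℝ X →L[ℝ] StrongDual ℝ X)
  let K : StrongDual ℝ X →L[ℝ] Lp (StrongDual ℝ X) ∞ μ := Lp.constL ∞ μ ℝ
  let T' : Lp ℝ 1 μ →L[ℝ] StrongDual ℝ (StrongDual ℝ X) :=
    K.precomp ℝ ∘L Λ.postcomp _ ∘L B.holderL μ 1 ∞ 1
  have hT' : ∀ h φ, T' h φ = Λ (B.holder 1 h (Lp.const ∞ μ φ)) := fun _ _ ↦ rfl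
  let T : Lp ℝ 1 μ →L[ℝ] X := ι.symm.toContinuousLinearEquiv.toContinuousLinearMap ∘L T'
  have hT : ∀ h φ, φ (T h) = T' h φ := fun h φ ↦ by
    have : ι (ι.symm (T' h)) = T' h := ι.apply_symm_apply _
    conv_rhs => rw [← this]
    rfl
  refine ⟨T, fun φ s hs ↦ ?_⟩
  rw [hT, hT']
  congr 1
  apply Lp.ext
  refine (ContinuousLinearMap.coeFn_holder _ _ _).trans ?_
  filter_upwards [indicatorConstLp_coeFn (p := 1) (hs := hs) (hμs := measure_ne_top μ s)
    (c := (1 : ℝ)), indicatorConstLp_coeFn (p := 1) (hs := hs) (hμs := measure_ne_top μ s)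
    (c := φ), Lp.coeFn_const ∞ μ φ] with t h1 h2 h3
  rw [h1, h2, h3]
  by_cases ht : t ∈ s <;> simp [ht, B]

/-- Functionals on `L¹(I, X*)` with `X` reflexive are represented by functions in `L^∞(I, X)`. -/
lemma exists_representation_dual_L1 {X : Type*} [NormedAddCommGroup X] [NormedSpace ℝ X]
    [CompleteSpace X] (hrefl : Function.Surjective (NormedSpace.inclusionInDoubleDual ℝ X))
    {a b : ℝ} {μ : Measure ℝ} [IsFiniteMeasure μ] (hμ : μ = volume.restrict (Icc a b))
    (Λ : StrongDual ℝ (Lp (StrongDual ℝ X) 1 μ)) :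
    ∃ u : ℝ → X, MemLp u ∞ μ ∧ ∀ g : Lp (StrongDual ℝ X) 1 μ, Λ g = ∫ t, g t (u t) ∂μ := by
  obtain ⟨T, hT⟩ := exists_operator_of_dual_L1 hrefl Λ
  obtain ⟨u, hum, hub, hu⟩ := exists_density_of_reflexive hrefl hμ T
  have hL : MemLp u ∞ μ := memLp_top_of_bound hum _ (Eventually.of_forall hub)
  refine ⟨u, hL, ?_⟩
  obtain ⟨B, hB⟩ : ∃ B : StrongDual ℝ X →L[ℝ] X →L[ℝ] ℝ, ∀ φ x, B φ x = φ x :=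
    ⟨.id ℝ _, fun _ _ ↦ rfl⟩
  let P : Lp (StrongDual ℝ X) 1 μ →L[ℝ] ℝ := (B.lpPairing μ 1 ∞).flip hL.toLp
  have hP : ∀ g : Lp (StrongDual ℝ X) 1 μ, P g = ∫ t, g t (u t) ∂μ := fun g ↦ by
    refine (B.lpPairing_eq_integral g hL.toLp).trans (integral_congr_ae ?_)
    filter_upwards [hL.coeFn_toLp] with t ht
    rw [ht, hB]
  intro g
  rw [← hP]
  induction g using Lp.induction ENNReal.one_ne_top with
  | @indicatorConst c s hs hμs =>
    rw [Lp.simpleFunc.coe_indicatorConst, ← hT c _ hs, hu c _ hs, hP,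
      ← integral_indicator hs]
    refine integral_congr_ae ?_
    filter_upwards [indicatorConstLp_coeFn (p := 1) (hs := hs) (hμs := hμs.ne)
      (c := c)] with t ht
    rw [ht]
    by_cases h : t ∈ s <;> simp [h]
  | add hf hg _ h1 h2 => rw [map_add, map_add, h1, h2]
  | isClosed => exact isClosed_eq Λ.continuous P.continuous

/-- A linear functional dominated by `‖G ·‖` factors through `G` as a continuous functional. -/
lemma exists_dual_factor_of_le {V W : Type*} [AddCommGroup V] [Module ℝ V]
    [NormedAddCommGroup W] [NormedSpace ℝ W] (G : V →ₗ[ℝ] W) (ℓ : V →ₗ[ℝ] ℝ) {C : ℝ}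
    (h : ∀ v, |ℓ v| ≤ C * ‖G v‖) : ∃ Λ : StrongDual ℝ W, ∀ v, Λ (G v) = ℓ v := by
  obtain ⟨s, hs⟩ := G.rangeRestrict.exists_rightInverse_of_surjective G.range_rangeRestrict
  have hGs : ∀ w, G (s w) = w := fun w ↦ congrArg Subtype.val (LinearMap.congr_fun hs w)
  let Λ₀ : StrongDual ℝ (LinearMap.range G) := (ℓ ∘ₗ s).mkContinuous C fun w ↦ by
    simpa [hGs] using h (s w)
  obtain ⟨Λ, hΛ, -⟩ := exists_extension_norm_eq _ Λ₀
  refine ⟨Λ, fun v ↦ ?_⟩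
  have h1 : Λ (G v) = ℓ (s ⟨G v, v, rfl⟩) := hΛ ⟨G v, v, rfl⟩
  have h2 := h (s ⟨G v, v, rfl⟩ - v)
  rw [map_sub G, hGs] at h2
  simp only [sub_self, norm_zero, mul_zero, abs_nonpos_iff, map_sub] at h2
  rw [h1, sub_eq_zero.1 h2]

/-- The triples `(f, f', A* f)` of test functions on `[a, b]`, their derivatives, and their images
under the adjoints of `A t`. -/
def testSpace {X : Type*} [NormedAddCommGroup X] [NormedSpace ℝ X] (a b : ℝ)
    (A : ℝ → (X →ₗ.[ℝ] X)) :
    Submodule ℝ ((ℝ → StrongDual ℝ X) × (ℝ → StrongDual ℝ X) × (ℝ → StrongDual ℝ X)) where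
  carrier := {F | (∀ t ∈ Icc a b, HasDerivAt F.1 (F.2.1 t) t) ∧ ContinuousOn F.2.1 (Icc a b) ∧
    (∀ t ∈ Icc a b, ∀ y : (A t).domain, F.2.2 t (y : X) = F.1 t ((A t) y)) ∧
    ContinuousOn F.2.2 (Icc a b) ∧ F.1 b = 0}
  zero_mem' := ⟨fun t _ ↦ hasDerivAt_const t 0, continuousOn_const, fun _ _ _ ↦ rfl,
    continuousOn_const, rfl⟩
  add_mem' := by
    rintro F F' ⟨h1, h2, h3, h4, h5⟩ ⟨h1', h2', h3', h4', h5'⟩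
    refine ⟨fun t ht ↦ (h1 t ht).add (h1' t ht), h2.add h2', fun t ht y ↦ ?_, h4.add h4', ?_⟩
    · simp [h3 t ht y, h3' t ht y]
    · simp [h5, h5']
  smul_mem' := by
    rintro c F ⟨h1, h2, h3, h4, h5⟩
    refine ⟨fun t ht ↦ (h1 t ht).const_smul c, h2.const_smul c, fun t ht y ↦ ?_,
      h4.const_smul c, ?_⟩
    · simp [h3 t ht y]
    · simp [h5]

/-- **Existence of weak solutions (Theorem of Sohr, Theorem 2.10).**
Let `X` be a reflexive Banach space, `I = [a,b]`, `1 < p < ∞`,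
`1/p + 1/q = 1`, and for every `t ∈ I` let `A(t)` generate a strongly
continuous semigroup of contractions (expressed via the Hille–Yosida
conditions: `A(t)` densely defined with resolvents `‖R(λ,A(t))‖ ≤ 1/λ` for
`λ > 0`). Then for every initial value `x ∈ X` there exists a weak solution
`u ∈ L^p(I,X)` of the nonautonomous Cauchy problem `u' = A(t)u`, `u(a) = x`:
`∫_I [(ḟ(t),u(t)) + (A(t)*f(t),u(t))] dt + (f(a),x) = 0` for all test
functions `f` in the class `𝒯`. -/
theorem weak_solution_exists
    {X : Type*} [NormedAddCommGroup X] [NormedSpace ℝ X] [CompleteSpace X]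
    -- `X` reflexive
    (hrefl : Function.Surjective (NormedSpace.inclusionInDoubleDual ℝ X))
    (a b : ℝ) (hab : a < b)
    (p q : ℝ) (hp : 1 < p) (hpq : 1 / p + 1 / q = 1)
    -- the operators `A(t)`
    (A : ℝ → (X →ₗ.[ℝ] X))
    (hdense : ∀ t ∈ Icc a b, Dense ((A t).domain : Set X))
    -- Hille–Yosida: resolvents of norm `≤ 1/λ` for all `λ > 0`
    (Res : ℝ → ℝ → X →L[ℝ] X)
    (hRes_mem : ∀ t ∈ Icc a b, ∀ lam : ℝ, 0 < lam → ∀ x : X,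
      ∃ h : Res lam t x ∈ (A t).domain,
        lam • Res lam t x - (A t) ⟨Res lam t x, h⟩ = x)
    (hRes_inv : ∀ t ∈ Icc a b, ∀ lam : ℝ, 0 < lam → ∀ y : (A t).domain,
      Res lam t (lam • (y : X) - (A t) y) = (y : X))
    (hRes_bound : ∀ t ∈ Icc a b, ∀ lam : ℝ, 0 < lam →
      ‖Res lam t‖ ≤ lam⁻¹)
    (x : X) :
    ∃ u : ℝ → X,
      MemLp u (ENNReal.ofReal p) (volume.restrict (Icc a b)) ∧
      -- `u` is a weak solution: for every test function `f ∈ 𝒯` ...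
      ∀ (f f' fA : ℝ → StrongDual ℝ X),
        -- `f` is continuously differentiable with derivative `f'`
        (∀ t ∈ Icc a b, HasDerivAt f (f' t) t) →
        ContinuousOn f' (Icc a b) →
        -- `f ∈ L^q(I, X*)`
        MemLp f (ENNReal.ofReal q) (volume.restrict (Icc a b)) →
        -- `f(t) ∈ D(A(t)*)` with `A(t)* f(t) = fA t`, i.e. the functional
        -- `fA t` represents `f(t) ∘ A(t)` on `D(A(t))`
        (∀ t ∈ Icc a b, ∀ y : (A t).domain, fA t (y : X) = f t ((A t) y)) →
        -- `t ↦ A(t)* f(t)` is continuous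
        ContinuousOn fA (Icc a b) →
        -- `f(b) = 0`
        f b = 0 →
        (∫ t in a..b, ((f' t) (u t) + (fA t) (u t))) + (f a) x = 0 := by
  set μ := volume.restrict (Icc a b) with hμ
  have hint : ∀ F : testSpace a b A, Integrable (fun t ↦ F.1.2.1 t + F.1.2.2 t) μ := fun F ↦
    (F.2.2.1.add F.2.2.2.2.1).integrableOn_compact isCompact_Icc
  let G : testSpace a b A →ₗ[ℝ] Lp (StrongDual ℝ X) 1 μ :=
    { toFun := fun F ↦ (hint F).toL1 _
      map_add' := fun F F' ↦ by
        rw [← Integrable.toL1_add]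
        exact (Integrable.toL1_eq_toL1_iff _ _ _ _).2
          (Eventually.of_forall fun t ↦ add_add_add_comm _ _ _ _)
      map_smul' := fun c F ↦ by
        rw [RingHom.id_apply, ← Integrable.toL1_smul]
        exact (Integrable.toL1_eq_toL1_iff _ _ _ _).2
          (Eventually.of_forall fun t ↦ (smul_add c _ _).symm) }
  let ℓ : testSpace a b A →ₗ[ℝ] ℝ :=
    { toFun := fun F ↦ -(F.1.1 a x)
      map_add' := fun F F' ↦ neg_add _ _
      map_smul' := fun c F ↦ (mul_neg c _).symm }
  have hℓ : ∀ F, |ℓ F| ≤ ‖x‖ * ‖G F‖ := fun F ↦ by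
    have h1 : ‖F.1.1 a‖ ≤ ‖G F‖ := by
      have h2 : ‖G F‖ = ∫ t in a..b, ‖F.1.2.1 t + F.1.2.2 t‖ := by
        rw [intervalIntegral.integral_of_le hab.le, ← integral_Icc_eq_integral_Ioc]
        exact L1.norm_of_fun_eq_integral_norm (hint F)
      rw [h2]
      refine norm_le_integral_of_dissipative hab.le F.2.1 F.2.2.1 F.2.2.2.2.1
        (fun t ht h hh ↦ ?_) F.2.2.2.2.2
      exact norm_le_norm_sub_smul_of_resolvent hh (hRes_mem t ht h⁻¹ (inv_pos.2 hh))
        ((hRes_bound t ht h⁻¹ (inv_pos.2 hh)).trans_eq (inv_inv h)) (F.2.2.2.1 t ht)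
    calc |ℓ F| = ‖F.1.1 a x‖ := abs_neg _
      _ ≤ ‖F.1.1 a‖ * ‖x‖ := (F.1.1 a).le_opNorm x
      _ ≤ ‖G F‖ * ‖x‖ := by gcongr
      _ = _ := mul_comm _ _
  obtain ⟨Λ, hΛ⟩ := exists_dual_factor_of_le (V := testSpace a b A)
    (W := Lp (StrongDual ℝ X) 1 μ) (C := ‖x‖) G ℓ hℓ
  obtain ⟨u, hu, hΛu⟩ := exists_representation_dual_L1 hrefl hμ Λ
  refine ⟨u, hu.mono_exponent le_top, fun f f' fA hf hf' _ hfA hfAc hfb ↦ ?_⟩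
  let F : testSpace a b A := ⟨(f, f', fA), hf, hf', hfA, hfAc, hfb⟩
  have h1 : Λ (G F) = -(f a x) := hΛ F
  rw [hΛu] at h1
  rw [intervalIntegral.integral_of_le hab.le, ← integral_Icc_eq_integral_Ioc,
    ← add_neg_cancel (-(f a x)), neg_neg, ← h1]
  congr 1
  refine integral_congr_ae ?_
  filter_upwards [(hint F).coeFn_toL1] with t ht
  change _ = ((hint F).toL1 _ : ℝ → StrongDual ℝ X) t (u t)
  rw [ht]
  rfl
end

section
/- Let B and C be maximally accretive operators on a Hilbert space X such that C⁻¹ exists as a bounded operator on X, and let 𝒟 be a core of B*. If there exists 0 ≤ a < 1 such that Re(B*x, C⁻¹x) + a‖x‖² ≥ 0 for every x ∈ 𝒟, then B + C with domain D(B+C) = D(B) ∩ D(C) is maximally accretive. -/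
open MeasureTheory Set Filter InnerProductSpace
open scoped Topology ComplexConjugate

/-- An (unbounded, densely defined) operator on a Hilbert space is *maximally
accretive* iff it is densely defined, accretive, and `A + β` is surjective for
some `β > 0` (this range characterization of maximal accretivity is the
standard equivalent formulation on Hilbert spaces). -/
def LinearPMap.MaxAccretive {X : Type*} [NormedAddCommGroup X]
    [InnerProductSpace ℂ X] (A : X →ₗ.[ℂ] X) : Prop :=
  Dense (A.domain : Set X) ∧
  (∀ x : A.domain, 0 ≤ (inner ℂ (A x) (x : X) : ℂ).re) ∧
  ∃ β : ℝ, 0 < β ∧ ∀ y : X, ∃ x : A.domain, A x + (β : ℂ) • (x : X) = y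

open scoped LinearPMap

/-- A linear map on a subspace that is bounded below has a surjective (formal) adjoint. -/
theorem LinearMap.exists_inner_eq_of_le_norm {X : Type*} [NormedAddCommGroup X]
    [InnerProductSpace ℂ X] [CompleteSpace X] {D : Submodule ℂ X} (T : D →ₗ[ℂ] X) {c : ℝ}
    (hc : 0 < c) (hT : ∀ x : D, c * ‖(x : X)‖ ≤ ‖T x‖) (y : X) :
    ∃ u : X, ∀ x : D, inner ℂ u (T x) = inner ℂ y (x : X) := by
  have hinj : Function.Injective T := by
    refine (injective_iff_map_eq_zero T).2 fun x hx => ?_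
    have h := hT x
    rw [hx, norm_zero] at h
    have h0 : ‖(x : X)‖ ≤ 0 := nonpos_of_mul_nonpos_right h hc
    exact Subtype.ext (norm_le_zero_iff.1 h0)
  let e := LinearEquiv.ofInjective T hinj
  let φ : LinearMap.range T →L[ℂ] ℂ :=
    LinearMap.mkContinuous (((innerₛₗ ℂ y).comp D.subtype).comp e.symm.toLinearMap)
      (‖y‖ / c) (fun r => by
        obtain ⟨x, rfl⟩ := e.surjective r
        have h1 : ‖e x‖ = ‖T x‖ := rfl
        have h2 : ‖inner ℂ y (x : X)‖ ≤ ‖y‖ * ‖(x : X)‖ := norm_inner_le_norm _ _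
        have h3 : ‖y‖ / c * (c * ‖(x : X)‖) ≤ ‖y‖ / c * ‖T x‖ := by
          gcongr
          exact hT x
        have h4 : ‖y‖ / c * (c * ‖(x : X)‖) = ‖y‖ * ‖(x : X)‖ := by field_simp
        simp only [LinearMap.comp_apply, LinearEquiv.coe_coe, LinearEquiv.symm_apply_apply,
          Submodule.subtype_apply, innerₛₗ_apply_apply, h1]
        linarith)
  obtain ⟨g, hg, -⟩ := exists_extension_norm_eq (LinearMap.range T) φ
  refine ⟨(InnerProductSpace.toDual ℂ X).symm g, fun x => ?_⟩
  rw [InnerProductSpace.toDual_symm_apply]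
  have h := hg (e x)
  have h1 : ((e x : LinearMap.range T) : X) = T x := rfl
  rw [h1] at h
  rw [h]
  simp [φ]

/-- A linear map on a subspace with numerical range in `{re ≥ c}` is bounded below by `c`. -/
theorem mul_norm_le_norm_of_mul_sq_le_re_inner {X : Type*} [NormedAddCommGroup X]
    [InnerProductSpace ℂ X] {c : ℝ} {x y : X}
    (h : c * ‖x‖ ^ 2 ≤ (inner ℂ y x : ℂ).re) : c * ‖x‖ ≤ ‖y‖ := by
  rcases (norm_nonneg x).eq_or_lt' with hx | hx
  · simp [hx]
  · have h1 : (inner ℂ y x : ℂ).re ≤ ‖y‖ * ‖x‖ := re_inner_le_norm (𝕜 := ℂ) y x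
    refine le_of_mul_le_mul_right ?_ hx
    nlinarith

namespace LinearPMap

variable {X : Type*} [NormedAddCommGroup X] [InnerProductSpace ℂ X]

/-- An accretive operator `A` with `A + β` onto for some `β > 0` is densely defined. -/
theorem dense_domain_of_accretive_of_surjective [CompleteSpace X] {A : X →ₗ.[ℂ] X}
    (hA : ∀ x : A.domain, 0 ≤ (inner ℂ (A x) (x : X) : ℂ).re) {β : ℝ} (hβ : 0 < β)
    (hsurj : ∀ y : X, ∃ x : A.domain, A x + (β : ℂ) • (x : X) = y) :
    Dense (A.domain : Set X) := by
  rw [Submodule.dense_iff_topologicalClosure_eq_top,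
    Submodule.topologicalClosure_eq_top_iff, Submodule.eq_bot_iff]
  intro v hv
  obtain ⟨x, hx⟩ := hsurj v
  have h0 : inner ℂ v (x : X) = 0 := (Submodule.mem_orthogonal' _ _).1 hv x x.2
  have h1 : (inner ℂ v (x : X) : ℂ).re = (inner ℂ (A x) (x : X) : ℂ).re + β * ‖(x : X)‖ ^ 2 := by
    rw [← hx, inner_add_left, inner_smul_left, inner_self_eq_norm_sq_to_K, Complex.add_re]
    simp [← Complex.ofReal_pow]
  rw [h0, Complex.zero_re] at h1
  have h2 : β * ‖(x : X)‖ ^ 2 ≤ 0 := by linarith [hA x]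
  have h3 : ‖(x : X)‖ ^ 2 ≤ 0 := nonpos_of_mul_nonpos_right h2 hβ
  have h4 : (x : X) = 0 := by
    rw [← norm_eq_zero]
    exact pow_eq_zero_iff two_ne_zero |>.1 (le_antisymm h3 (sq_nonneg _))
  have h5 : x = 0 := Subtype.ext h4
  rw [← hx, h5]
  simp

/-- If `A` is densely defined and accretive, then `A† + β` is onto for every `β > 0`. -/
theorem exists_adjoint_add_smul_eq [CompleteSpace X] {A : X →ₗ.[ℂ] X}
    (hd : Dense (A.domain : Set X))
    (hA : ∀ x : A.domain, 0 ≤ (inner ℂ (A x) (x : X) : ℂ).re) {β : ℝ} (hβ : 0 < β) (y : X) :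
    ∃ u : A†.domain, A† u + (β : ℂ) • (u : X) = y := by
  have hT : ∀ x : A.domain, β * ‖(x : X)‖ ≤ ‖(A.toFun + (β : ℂ) • A.domain.subtype) x‖ := by
    intro x
    refine mul_norm_le_norm_of_mul_sq_le_re_inner ?_
    have h := hA x
    simp only [LinearMap.add_apply, LinearMap.smul_apply, Submodule.subtype_apply, toFun_eq_coe,
      inner_add_left, inner_smul_left, inner_self_eq_norm_sq_to_K, Complex.add_re]
    simp [← Complex.ofReal_pow]
    exact h
  obtain ⟨u, hu⟩ := LinearMap.exists_inner_eq_of_le_norm _ hβ hT y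
  have hw : ∀ x : A.domain, inner ℂ (y - (β : ℂ) • u) (x : X) = inner ℂ u (A x) := by
    intro x
    rw [inner_sub_left, ← hu x]
    simp only [LinearMap.add_apply, LinearMap.smul_apply, Submodule.subtype_apply, toFun_eq_coe,
      inner_add_right, inner_smul_left, inner_smul_right, Complex.conj_ofReal]
    ring
  refine ⟨⟨u, mem_adjoint_domain_of_exists u ⟨_, hw⟩⟩, ?_⟩
  rw [adjoint_apply_eq hd _ hw]
  simp

/-- A maximally accretive operator contains its second adjoint. -/
theorem MaxAccretive.exists_apply_eq_of_inner_adjoint [CompleteSpace X] {A : X →ₗ.[ℂ] X}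
    (hA : A.MaxAccretive) {w f : X}
    (h : ∀ u : A†.domain, inner ℂ w (A† u) = inner ℂ f (u : X)) :
    ∃ hw : w ∈ A.domain, A ⟨w, hw⟩ = f := by
  obtain ⟨hd, hacc, β, hβ, hsurj⟩ := hA
  obtain ⟨z, hz⟩ := hsurj (f + (β : ℂ) • w)
  obtain ⟨u, hu⟩ := exists_adjoint_add_smul_eq hd hacc hβ (w - z)
  have h1 : inner ℂ (z : X) (A† u) = inner ℂ (A z) (u : X) :=
    ((adjoint_isFormalAdjoint hd).symm z u).symm
  have h2 : inner ℂ (w - (z : X)) (w - (z : X)) = (0 : ℂ) := by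
    have hAz : A z = f + (β : ℂ) • w - (β : ℂ) • (z : X) := eq_sub_of_add_eq hz
    nth_rw 2 [← hu]
    rw [inner_sub_left, inner_add_right, inner_add_right, h u, h1, hAz]
    simp only [inner_sub_left, inner_add_left, inner_smul_left, inner_smul_right,
      Complex.conj_ofReal]
    ring
  have h3 : w = z := sub_eq_zero.1 (inner_self_eq_zero.1 h2)
  subst h3
  exact ⟨z.2, by simpa using hz⟩

/-- A lower bound on `re ⟪A x, K x⟫` with `K` bounded extends from a core of `A`. -/
theorem re_inner_add_nonneg_of_core {A : X →ₗ.[ℂ] X} (K : X →L[ℂ] X) {𝒟 : Set X}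
    (hcore : ∀ x : A.domain, ∀ ε : ℝ, 0 < ε →
      ∃ d : A.domain, (d : X) ∈ 𝒟 ∧ ‖(x : X) - (d : X)‖ + ‖A x - A d‖ < ε) {a : ℝ}
    (h : ∀ x : A.domain, (x : X) ∈ 𝒟 →
      0 ≤ (inner ℂ (A x) (K (x : X)) : ℂ).re + a * ‖(x : X)‖ ^ 2) (x : A.domain) :
    0 ≤ (inner ℂ (A x) (K (x : X)) : ℂ).re + a * ‖(x : X)‖ ^ 2 := by
  choose d hd𝒟 hd using fun n : ℕ => hcore x (1 / ((n : ℝ) + 1)) Nat.one_div_pos_of_nat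
  have hlim := tendsto_one_div_add_atTop_nhds_zero_nat (𝕜 := ℝ)
  have h1 : Tendsto (fun n => (d n : X)) atTop (𝓝 (x : X)) := by
    rw [tendsto_iff_norm_sub_tendsto_zero]
    refine squeeze_zero (fun _ => norm_nonneg _) (fun n => ?_) hlim
    rw [norm_sub_rev]
    linarith [hd n, norm_nonneg (A x - A (d n))]
  have h2 : Tendsto (fun n => A (d n)) atTop (𝓝 (A x)) := by
    rw [tendsto_iff_norm_sub_tendsto_zero]
    refine squeeze_zero (fun _ => norm_nonneg _) (fun n => ?_) hlim
    rw [norm_sub_rev]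
    linarith [hd n, norm_nonneg ((x : X) - (d n : X))]
  have h3 : Tendsto (fun n => (inner ℂ (A (d n)) (K (d n : X)) : ℂ).re + a * ‖(d n : X)‖ ^ 2)
      atTop (𝓝 ((inner ℂ (A x) (K (x : X)) : ℂ).re + a * ‖(x : X)‖ ^ 2)) :=
    ((Complex.continuous_re.tendsto _).comp
      (h2.inner ((K.continuous.tendsto _).comp h1))).add ((h1.norm.pow 2).const_mul a)
  exact ge_of_tendsto' h3 fun n => h (d n) (hd𝒟 n)

end LinearPMap

/-- **Maximal accretivity of an operator sum (Lemma B.1).**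
Let `B` and `C` be maximally accretive operators on a Hilbert space `X` such
that `C⁻¹` exists as a bounded operator, and let `𝒟` be a core of `B*`.
If there is `0 ≤ a < 1` with `Re(B*x, C⁻¹x) + a‖x‖² ≥ 0` for all `x ∈ 𝒟`,
then `B + C` with domain `D(B) ∩ D(C)` is maximally accretive. -/
theorem operator_sum_maxAccretive
    {X : Type*} [NormedAddCommGroup X] [InnerProductSpace ℂ X] [CompleteSpace X]
    (B C : X →ₗ.[ℂ] X)
    (hB : B.MaxAccretive) (hC : C.MaxAccretive)
    -- `C⁻¹` exists as a bounded operator on `X`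
    (Cinv : X →L[ℂ] X)
    (hCinv_mem : ∀ y : X, ∃ h : Cinv y ∈ C.domain, C ⟨Cinv y, h⟩ = y)
    (hCinv_left : ∀ x : C.domain, Cinv (C x) = (x : X))
    -- `𝒟` is a core of `B*`
    (𝒟 : Set X) (h𝒟_sub : 𝒟 ⊆ (B.adjoint.domain : Set X))
    (h𝒟_core : ∀ x : B.adjoint.domain, ∀ ε : ℝ, 0 < ε →
      ∃ d : B.adjoint.domain, (d : X) ∈ 𝒟 ∧
        ‖(x : X) - (d : X)‖ + ‖B.adjoint x - B.adjoint d‖ < ε)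
    -- the angle condition
    (a : ℝ) (ha0 : 0 ≤ a) (ha1 : a < 1)
    (hangle : ∀ x : B.adjoint.domain, (x : X) ∈ 𝒟 →
      0 ≤ (inner ℂ (B.adjoint x) (Cinv (x : X)) : ℂ).re + a * ‖(x : X)‖ ^ 2) :
    (B + C).MaxAccretive := by
  have hacc : ∀ x : (B + C).domain, 0 ≤ (inner ℂ ((B + C) x) (x : X) : ℂ).re := by
    intro x
    rw [LinearPMap.add_apply, inner_add_left, Complex.add_re]
    exact add_nonneg (hB.2.1 ⟨x, x.2.1⟩) (hC.2.1 ⟨x, x.2.2⟩)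
  have hsurj : ∀ y : X, ∃ x : (B + C).domain, (B + C) x + ((1 : ℝ) : ℂ) • (x : X) = y := by
    intro y
    let S : B†.domain →ₗ[ℂ] X := B†.domain.subtype +
      (ContinuousLinearMap.adjoint Cinv).toLinearMap ∘ₗ (B†.domain.subtype + B†.toFun)
    have hS_apply : ∀ u, S u = (u : X) + ContinuousLinearMap.adjoint Cinv ((u : X) + B† u) :=
      fun _ => rfl
    have hS : ∀ u : B†.domain, (1 - a) * ‖(u : X)‖ ≤ ‖S u‖ := by
      intro u
      refine mul_norm_le_norm_of_mul_sq_le_re_inner ?_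
      have h1 := LinearPMap.re_inner_add_nonneg_of_core Cinv h𝒟_core hangle u
      have h2 : 0 ≤ (inner ℂ (u : X) (Cinv (u : X)) : ℂ).re := by
        obtain ⟨hm, hCu⟩ := hCinv_mem (u : X)
        simpa [hCu] using hC.2.1 ⟨_, hm⟩
      have h3 : (inner ℂ (u : X) (u : X) : ℂ).re = ‖(u : X)‖ ^ 2 :=
        inner_self_eq_norm_sq (𝕜 := ℂ) (u : X)
      rw [hS_apply, inner_add_left, ContinuousLinearMap.adjoint_inner_left, inner_add_left,
        Complex.add_re, Complex.add_re, h3]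
      linarith
    obtain ⟨x, hx⟩ := S.exists_inner_eq_of_le_norm (sub_pos.2 ha1) hS y
    have hBx : ∀ u : B†.domain,
        inner ℂ (Cinv x) (B† u) = inner ℂ (y - x - Cinv x) (u : X) := by
      intro u
      have h := hx u
      rw [hS_apply, inner_add_right, ContinuousLinearMap.adjoint_inner_right,
        inner_add_right] at h
      rw [inner_sub_left, inner_sub_left, ← h]
      ring
    obtain ⟨hmB, hBeq⟩ := hB.exists_apply_eq_of_inner_adjoint hBx
    obtain ⟨hmC, hCeq⟩ := hCinv_mem x
    refine ⟨⟨Cinv x, hmB, hmC⟩, ?_⟩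
    rw [LinearPMap.add_apply, hBeq, hCeq, Complex.ofReal_one, one_smul]
    abel
  exact ⟨LinearPMap.dense_domain_of_accretive_of_surjective hacc one_pos hsurj, hacc,
    1, one_pos, hsurj⟩
end
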